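/- arXiv:1803.09738 — 3 statements merged into one kernel-verified Lean document; each statement's English description precedes it below -/
import Mathlib

section
/- For every integer n ≥ 1, the triple sum U_3 satisfies the recurrence U_3(n+2) = -q^{9n+12} U_3(n) in ℚ(q). -/
open Finset

noncomputable def q : RatFunc ℚ := RatFunc.X

noncomputable def qPoch (a : RatFunc ℚ) (n : ℕ) : RatFunc ℚ :=
  ∏ k ∈ Finset.range n, (1 - a * q ^ k)

noncomputable def qPochZ (a : RatFunc ℚ) (n : ℤ) : RatFunc ℚ :=
  if 0 ≤ n then qPoch a n.toNat else 1 / qPoch (a * q ^ n) (-n).toNat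

noncomputable def qbinom (n m : ℤ) : RatFunc ℚ :=
  if 0 ≤ m ∧ m ≤ n then
    qPoch q n.toNat / (qPoch q m.toNat * qPoch q (n - m).toNat)
  else 0

/-- The multiple sum `U_m(n)`, with the cyclic convention `r_{m+1} = r_1`. -/
noncomputable def Umul (m : ℕ) [NeZero m] (n : ℕ) : RatFunc ℚ :=
  ∑ r ∈ Fintype.piFinset (fun _ : Fin m => Finset.range (2 * n + 2)),
    ∏ k : Fin m,
      ((-1 : RatFunc ℚ) ^ r k * q ^ (r k * (r k - 1) / 2) *
        qPochZ (-q) ((n : ℤ) - r k) * qbinom (2 * (n : ℤ) - r k + 1) (r (k + 1)))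

/-- The multiple sum `W_m(n)`, with the cyclic convention `r_{m+1} = r_1`. -/
noncomputable def Wmul (m : ℕ) [NeZero m] (n : ℕ) : RatFunc ℚ :=
  ∑ r ∈ Fintype.piFinset (fun _ : Fin m => Finset.range (2 * n + 1)),
    ∏ k : Fin m,
      ((-1 : RatFunc ℚ) ^ r k * q ^ (r k * (r k - 1) / 2) *
        qPochZ (-q) ((n : ℤ) - r k) * qbinom (2 * (n : ℤ) - r k) (r (k + 1)))

namespace QTrace

lemma q_ne_zero : q ≠ 0 := RatFunc.X_ne_zero

lemma q_pow_ne_one {k : ℕ} (hk : k ≠ 0) : q ^ k ≠ 1 := by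
  intro h
  have h' : algebraMap (Polynomial ℚ) (RatFunc ℚ) (Polynomial.X ^ k) =
      algebraMap (Polynomial ℚ) (RatFunc ℚ) 1 := by
    simpa [q] using h
  have h'' := congrArg Polynomial.natDegree (RatFunc.algebraMap_injective ℚ h')
  simp only [Polynomial.natDegree_X_pow, Polynomial.natDegree_one] at h''
  exact hk h''

lemma q_zpow_eq_one_iff {k : ℤ} : q ^ k = 1 ↔ k = 0 := by
  refine ⟨fun h => ?_, fun h => by simp [h]⟩
  by_contra hk
  rcases Int.natAbs_eq k with h' | h'
  · rw [h', zpow_natCast] at h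
    exact q_pow_ne_one (by omega) h
  · rw [h', zpow_neg, zpow_natCast, inv_eq_one] at h
    exact q_pow_ne_one (by omega) h

lemma one_sub_q_zpow_ne_zero {k : ℤ} (hk : k ≠ 0) : 1 - q ^ k ≠ 0 := fun h =>
  hk (q_zpow_eq_one_iff.1 (sub_eq_zero.1 h).symm)

lemma one_add_q_zpow_ne_zero (k : ℤ) : 1 + q ^ k ≠ 0 := by
  intro h
  have h1 : q ^ k = -1 := (neg_eq_of_add_eq_zero_right h).symm
  have h2 : q ^ (k + k) = 1 := by rw [zpow_add₀ q_ne_zero, h1]; norm_num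
  have h3 : k = 0 := by have := q_zpow_eq_one_iff.1 h2; omega
  subst h3
  norm_num at h1

/-- The signed Gaussian weight `(-1)^k q^(k(k-1)/2)`, for every integer `k`. -/
noncomputable def gaussWeight (k : ℤ) : RatFunc ℚ := (-1) ^ k * q ^ (k * (k - 1) / 2)

lemma gaussWeight_ne_zero (k : ℤ) : gaussWeight k ≠ 0 :=
  mul_ne_zero (zpow_ne_zero _ (by norm_num)) (zpow_ne_zero _ q_ne_zero)

lemma gaussWeight_zero : gaussWeight 0 = 1 := by simp [gaussWeight]

lemma gaussWeight_add_one (k : ℤ) : gaussWeight (k + 1) = -q ^ k * gaussWeight k := by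
  have h : (k + 1) * (k + 1 - 1) / 2 = k + k * (k - 1) / 2 := by
    rw [show (k + 1) * (k + 1 - 1) = k * (k - 1) + k * 2 by ring,
      Int.add_mul_ediv_right _ _ (by norm_num), add_comm]
  rw [gaussWeight, gaussWeight, h, zpow_add₀ q_ne_zero, zpow_add₀ (by norm_num), zpow_one]
  ring

lemma gaussWeight_natCast (r : ℕ) :
    gaussWeight r = (-1 : RatFunc ℚ) ^ r * q ^ (r * (r - 1) / 2) := by
  induction r with
  | zero => simp [gaussWeight]
  | succ r ih =>
    have h : (r + 1) * (r + 1 - 1) / 2 = r + r * (r - 1) / 2 := by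
      rcases r with _ | r
      · rfl
      · simp only [Nat.add_sub_cancel]
        rw [show (r + 1 + 1) * (r + 1) = (r + 1) * r + (r + 1) * 2 by ring,
          Nat.add_mul_div_right _ _ (by norm_num), add_comm]
    rw [Nat.cast_succ, gaussWeight_add_one, ih, h, zpow_natCast]
    ring

/-- `(q;q)_k`, with value `1` at negative `k`. -/
noncomputable def qFact (k : ℤ) : RatFunc ℚ := qPoch q k.toNat

/-- `1 / (q;q)_k`, with value `0` at negative `k`. -/
noncomputable def invFact (k : ℤ) : RatFunc ℚ := if 0 ≤ k then (qFact k)⁻¹ else 0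

lemma qFact_zero : qFact 0 = 1 := by simp [qFact, qPoch]

lemma qFact_add_one {k : ℤ} (hk : 0 ≤ k) : qFact (k + 1) = (1 - q ^ (k + 1)) * qFact k := by
  lift k to ℕ using hk
  rw [qFact, qFact, show ((k : ℤ) + 1).toNat = k + 1 by omega, Int.toNat_natCast, qPoch, qPoch,
    Finset.prod_range_succ, mul_comm]
  congr 2
  rw [← Nat.cast_succ, zpow_natCast, pow_succ']

lemma qFact_ne_zero (k : ℤ) : qFact k ≠ 0 := by
  rw [qFact, qPoch]
  refine Finset.prod_ne_zero_iff.2 fun i _ => ?_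
  have := one_sub_q_zpow_ne_zero (k := ((i + 1 : ℕ) : ℤ)) (by omega)
  rwa [zpow_natCast, pow_succ'] at this

lemma invFact_of_neg {k : ℤ} (hk : k < 0) : invFact k = 0 := if_neg (by omega)

lemma invFact_of_nonneg {k : ℤ} (hk : 0 ≤ k) : invFact k = (qFact k)⁻¹ := if_pos hk

lemma invFact_zero : invFact 0 = 1 := by rw [invFact_of_nonneg le_rfl, qFact_zero, inv_one]

lemma invFact_ne_zero {k : ℤ} (hk : 0 ≤ k) : invFact k ≠ 0 := by
  rw [invFact_of_nonneg hk]
  exact inv_ne_zero (qFact_ne_zero k)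

lemma invFact_eq (k : ℤ) : invFact k = (1 - q ^ (k + 1)) * invFact (k + 1) := by
  rcases lt_trichotomy k (-1) with hk | rfl | hk
  · rw [invFact_of_neg (by omega), invFact_of_neg (by omega), mul_zero]
  · simp [invFact_of_neg]
  · have h := one_sub_q_zpow_ne_zero (k := k + 1) (by omega)
    rw [invFact_of_nonneg (by omega), invFact_of_nonneg (by omega), qFact_add_one (by omega),
      mul_inv, mul_inv_cancel_left₀ h]

lemma qbinom_eq (a t : ℤ) :
    qbinom a t = qFact a * invFact t * invFact (a - t) := by
  unfold qbinom
  split_ifs with h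
  · rw [invFact_of_nonneg h.1, invFact_of_nonneg (by omega), div_eq_mul_inv, mul_inv, ← mul_assoc]
    rfl
  · rcases lt_or_ge t 0 with ht | ht
    · rw [invFact_of_neg ht]; ring
    · rw [invFact_of_neg (k := a - t) (by omega), mul_zero]

lemma qPochZ_neg_nat (a : RatFunc ℚ) (m : ℕ) :
    qPochZ a (-(m : ℤ)) = 1 / qPoch (a * q ^ (-(m : ℤ))) m := by
  rcases m with _ | m
  · simp [qPochZ, qPoch]
  · rw [qPochZ, if_neg (by omega)]
    simp

lemma qPochZ_add_one (k : ℤ) : qPochZ (-q) (k + 1) = (1 + q ^ (k + 1)) * qPochZ (-q) k := by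
  rcases lt_or_ge k 0 with hk | hk
  · obtain ⟨m, rfl⟩ : ∃ m : ℕ, k = -((m + 1 : ℕ) : ℤ) := ⟨(-k - 1).toNat, by omega⟩
    have hm : -((m + 1 : ℕ) : ℤ) + 1 = -(m : ℤ) := by push_cast; ring
    have hq : -q * q ^ (-((m + 1 : ℕ) : ℤ)) = -q ^ (-(m : ℤ)) := by
      rw [← hm, zpow_add₀ q_ne_zero, zpow_one]; ring
    have hp : qPoch (-q ^ (-(m : ℤ))) (m + 1) =
        qPoch (-q * q ^ (-(m : ℤ))) m * (1 + q ^ (-(m : ℤ))) := by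
      rw [qPoch, Finset.prod_range_succ', qPoch]
      congr 1
      · refine Finset.prod_congr rfl fun i _ => ?_
        rw [pow_succ]; ring
      · rw [pow_zero]; ring
    have h := one_add_q_zpow_ne_zero (-(m : ℤ))
    rw [hm, qPochZ_neg_nat, qPochZ_neg_nat, hq, hp, mul_comm (qPoch _ _), one_div, one_div,
      mul_inv, mul_inv_cancel_left₀ h]
  · lift k to ℕ using hk
    rw [qPochZ, qPochZ, if_pos (by omega), if_pos (by omega),
      show ((k : ℤ) + 1).toNat = k + 1 by omega, Int.toNat_natCast, qPoch, qPoch,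
      Finset.prod_range_succ, mul_comm]
    congr 1
    rw [← Nat.cast_succ, zpow_natCast, pow_succ']
    ring

lemma qPochZ_ne_zero (k : ℤ) : qPochZ (-q) k ≠ 0 := by
  have h0 : qPochZ (-q) 0 ≠ 0 := by simp [qPochZ, qPoch]
  induction k using Int.induction_on with
  | zero => exact h0
  | succ i ih =>
    rw [qPochZ_add_one]
    exact mul_ne_zero (one_add_q_zpow_ne_zero _) ih
  | pred i ih =>
    have h := qPochZ_add_one (-(i : ℤ) - 1)
    rw [sub_add_cancel] at h
    exact right_ne_zero_of_mul (h ▸ ih)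

/-- The tridiagonal matrix with subdiagonal `l`, diagonal `d` and superdiagonal `u`, each indexed
by the row. -/
noncomputable def band (N : ℕ) (l d u : ℤ → RatFunc ℚ) :
    Matrix (Fin (N + 1)) (Fin (N + 1)) (RatFunc ℚ) :=
  Matrix.of fun r s => (if (s : ℤ) = r then d r else 0) + (if (s : ℤ) = r + 1 then u r else 0) +
    (if (s : ℤ) = r - 1 then l r else 0)

/-- The matrix with entries `F r s` for `0 ≤ r, s ≤ N`. -/
noncomputable def kernel (N : ℕ) (F : ℤ → ℤ → RatFunc ℚ) :
    Matrix (Fin (N + 1)) (Fin (N + 1)) (RatFunc ℚ) :=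
  Matrix.of fun r s => F r s

lemma sum_ite_fin (N : ℕ) (a : ℤ) (G : ℤ → RatFunc ℚ) :
    ∑ s : Fin (N + 1), (if (s : ℤ) = a then G s else 0) =
      if 0 ≤ a ∧ a ≤ N then G a else 0 := by
  split_ifs with h
  · obtain ⟨m, rfl⟩ := Int.eq_ofNat_of_zero_le h.1
    rw [Finset.sum_eq_single (⟨m, by omega⟩ : Fin (N + 1))]
    · simp
    · intro b _ hb
      exact if_neg fun h' => hb (Fin.ext (by simpa using h'))
    · simp
  · refine Finset.sum_eq_zero fun s _ => if_neg fun h' => h ?_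
    have := s.is_lt
    omega

/-- A contiguity relation between the rows and columns of `F` intertwines two tridiagonal
matrices, as soon as the terms outside the square vanish. -/
lemma kernel_mul_band {N : ℕ} {F : ℤ → ℤ → RatFunc ℚ} {l d u l' d' u' : ℤ → RatFunc ℚ}
    (h : ∀ r s : ℤ, 0 ≤ r → r ≤ N → 0 ≤ s → s ≤ N →
      F r s * d s + F r (s - 1) * u (s - 1) + F r (s + 1) * l (s + 1) =
        d' r * F r s + u' r * F (r + 1) s + l' r * F (r - 1) s)
    (hu : ∀ r : ℤ, 0 ≤ r → F r (-1) * u (-1) = 0)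
    (hl : ∀ r : ℤ, 0 ≤ r → F r (N + 1) * l (N + 1) = 0)
    (hu' : ∀ s : ℤ, 0 ≤ s → u' N * F (N + 1) s = 0)
    (hl' : ∀ s : ℤ, s ≤ N → l' 0 * F (-1) s = 0) :
    kernel N F * band N l d u = band N l' d' u' * kernel N F := by
  ext r s
  have hr := r.is_lt
  have hs := s.is_lt
  have hL : (kernel N F * band N l d u) r s =
      F r s * d s + F r (s - 1) * u (s - 1) + F r (s + 1) * l (s + 1) := by
    have e : ∀ x : Fin (N + 1), kernel N F r x * band N l d u x s =
        (if (x : ℤ) = s then F r x * d x else 0) +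
        (if (x : ℤ) = s - 1 then F r x * u x else 0) +
        (if (x : ℤ) = s + 1 then F r x * l x else 0) := by
      intro x
      simp only [kernel, band, Matrix.of_apply, mul_add, mul_ite, mul_zero]
      congr 2
      · congr 1
        exact propext ⟨fun h => h.symm, fun h => h.symm⟩
      · congr 1
        exact propext ⟨fun h => by omega, fun h => by omega⟩
      · exact propext ⟨fun h => by omega, fun h => by omega⟩
    rw [Matrix.mul_apply, Finset.sum_congr rfl fun x _ => e x, Finset.sum_add_distrib,
      Finset.sum_add_distrib, sum_ite_fin N _ fun x => F r x * d x,
      sum_ite_fin N _ fun x => F r x * u x, sum_ite_fin N _ fun x => F r x * l x,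
      if_pos (by omega)]
    congr 1
    · congr 1
      split_ifs with h0
      · rfl
      · rw [show (s : ℤ) - 1 = -1 by omega, hu _ (by omega)]
    · split_ifs with h0
      · rfl
      · rw [show (s : ℤ) + 1 = N + 1 by omega, hl _ (by omega)]
  have hR : (band N l' d' u' * kernel N F) r s =
      d' r * F r s + u' r * F (r + 1) s + l' r * F (r - 1) s := by
    simp only [Matrix.mul_apply, kernel, band, Matrix.of_apply, add_mul, ite_mul, zero_mul,
      Finset.sum_add_distrib]
    rw [sum_ite_fin N _ fun x => d' r * F x s,
      sum_ite_fin N _ fun x => u' r * F x s, sum_ite_fin N _ fun x => l' r * F x s,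
      if_pos (by omega)]
    congr 1
    · congr 1
      split_ifs with h0
      · rfl
      · rw [show (r : ℤ) = N by omega, hu' _ (by omega)]
    · split_ifs with h0
      · rfl
      · rw [show (r : ℤ) = 0 by omega, zero_sub, hl' _ (by omega)]
  rw [hL, hR]
  exact h r s (by omega) (by omega) (by omega) (by omega)

/-- A matrix commuting with `diag(q^(-r))` is diagonal. -/
lemma apply_eq_zero_of_commute {N : ℕ} {X : Matrix (Fin (N + 1)) (Fin (N + 1)) (RatFunc ℚ)}
    (hX : X * band N 0 (fun r => q ^ (-r)) 0 = band N 0 (fun r => q ^ (-r)) 0 * X)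
    {r s : Fin (N + 1)} (hrs : r ≠ s) : X r s = 0 := by
  have hD : band N 0 (fun r => q ^ (-r)) 0 =
      Matrix.diagonal fun r : Fin (N + 1) => q ^ (-(r : ℤ)) := by
    ext i j
    by_cases hij : i = j
    · subst hij; simp [band]
    · have h2 : (j : ℕ) ≠ i := fun h => hij (Fin.ext h.symm)
      simp [band, h2, hij]
  rw [hD] at hX
  have h := congrFun (congrFun hX r) s
  rw [Matrix.mul_diagonal, Matrix.diagonal_mul, mul_comm, ← sub_eq_zero, ← sub_mul] at h
  refine (mul_eq_zero.1 h).resolve_left fun h' => hrs (Fin.ext ?_)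
  have h1 : q ^ (-(s : ℤ) + r) = 1 := by
    rw [zpow_add₀ q_ne_zero, sub_eq_zero.1 h', ← zpow_add₀ q_ne_zero, neg_add_cancel, zpow_zero]
  have := q_zpow_eq_one_iff.1 h1
  omega

/-- The row factor of the symmetrised transfer matrix. -/
noncomputable def rowFactor (n : ℕ) (r : ℤ) : RatFunc ℚ :=
  gaussWeight r * qPochZ (-q) (n - r) * qFact (2 * n + 1 - r) * invFact r

/-- The transfer matrix of `Umul`, conjugated by `diag((q;q)_r)`. -/
noncomputable def transfer (n : ℕ) :
    Matrix (Fin (2 * n + 1 + 1)) (Fin (2 * n + 1 + 1)) (RatFunc ℚ) :=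
  kernel (2 * n + 1) fun r s => rowFactor n r * invFact (2 * n + 1 - r - s)

/-- The inverse of `transfer`. -/
noncomputable def transferInv (n : ℕ) :
    Matrix (Fin (2 * n + 1 + 1)) (Fin (2 * n + 1 + 1)) (RatFunc ℚ) :=
  kernel (2 * n + 1) fun s r => gaussWeight (r + s - (2 * n + 1)) *
    invFact (r + s - (2 * n + 1)) / rowFactor n r

lemma rowFactor_ne_zero (n : ℕ) {r : ℤ} (hr : 0 ≤ r) : rowFactor n r ≠ 0 :=
  mul_ne_zero (mul_ne_zero (mul_ne_zero (gaussWeight_ne_zero _) (qPochZ_ne_zero _))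
    (qFact_ne_zero _)) (invFact_ne_zero hr)

lemma rowFactor_of_neg (n : ℕ) {r : ℤ} (hr : r < 0) : rowFactor n r = 0 := by
  rw [rowFactor, invFact_of_neg hr, mul_zero]

lemma rowFactor_eq (n : ℕ) {r : ℤ} (hr : r ≤ 2 * n) :
    rowFactor n r = -(q ^ r)⁻¹ * (1 + q ^ n / q ^ r) * (1 - q ^ (2 * n + 1) / q ^ r) *
      (1 - q * q ^ r) * rowFactor n (r + 1) := by
  have hq := q_ne_zero
  have h1 := qPochZ_add_one (n - (r + 1))
  have h2 := qFact_add_one (k := 2 * n + 1 - (r + 1)) (by omega)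
  have h3 := invFact_eq r
  have h4 := gaussWeight_add_one r
  rw [show (n : ℤ) - (r + 1) + 1 = n - r by ring] at h1
  rw [show (2 * n + 1 : ℤ) - (r + 1) + 1 = (2 * n + 1 : ℕ) - r by push_cast; ring] at h2
  rw [zpow_sub₀ hq, zpow_natCast] at h1 h2
  rw [zpow_add₀ hq, zpow_one] at h3
  have hz : q ^ r ≠ 0 := zpow_ne_zero _ hq
  rw [rowFactor, rowFactor, h1, h3, h4,
    show (2 * n + 1 : ℤ) - r = (2 * n + 1 : ℕ) - r by push_cast; ring, h2]
  field_simp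

/-- The first intertwiner, the image of `diag(q^(-r))` under conjugation by `transfer`. -/
noncomputable def upperBand (n : ℕ) :
    Matrix (Fin (2 * n + 1 + 1)) (Fin (2 * n + 1 + 1)) (RatFunc ℚ) :=
  band (2 * n + 1) 0 (fun r => q ^ r / q ^ (2 * n + 1))
    (fun r => (1 + q ^ n / q ^ r) * (1 - q ^ (2 * n + 1) / q ^ r) * (1 - q * q ^ r) /
      q ^ (2 * n + 1))

/-- The second intertwiner, the image of `upperBand` under conjugation by `transfer`. -/
noncomputable def middleBand (n : ℕ) :
    Matrix (Fin (2 * n + 1 + 1)) (Fin (2 * n + 1 + 1)) (RatFunc ℚ) :=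
  band (2 * n + 1) (fun r => -(q ^ r) ^ 2 / (q ^ (2 * n + 1) * q ^ 2 * q ^ n))
    (fun r => (q ^ n * (1 + q) * (q ^ r) ^ 2 -
      (q ^ n - q ^ (2 * n + 1) + q * q ^ n * q ^ (2 * n + 1)) * q ^ r) / (q ^ (2 * n + 1)) ^ 2)
    (fun r => q * q ^ n * q ^ r / (q ^ (2 * n + 1)) ^ 2 * (1 + q ^ n / q ^ r) *
      (1 - q ^ (2 * n + 1) / q ^ r) * (1 - q * q ^ r))

/-- The third intertwiner, the image of `middleBand` under conjugation by `transfer`. -/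
noncomputable def lowerBand (n : ℕ) :
    Matrix (Fin (2 * n + 1 + 1)) (Fin (2 * n + 1 + 1)) (RatFunc ℚ) :=
  band (2 * n + 1) (fun r => -(q ^ r / q ^ (2 * n + 1) / q)) (fun r => q ^ r / q ^ (2 * n + 1)) 0

/-- The diagonal matrix with entries `q^(-r)`. -/
noncomputable def diagBand (n : ℕ) :
    Matrix (Fin (2 * n + 1 + 1)) (Fin (2 * n + 1 + 1)) (RatFunc ℚ) :=
  band (2 * n + 1) 0 (fun r => q ^ (-r)) 0

lemma invFact_sub_eq (n : ℕ) (r s : ℤ) : invFact (2 * n + 1 - r - s - 1) =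
    (1 - q ^ (2 * n + 1) / q ^ r / q ^ s) * invFact (2 * n + 1 - r - s) := by
  rw [invFact_eq, sub_add_cancel, show (2 * n + 1 : ℤ) - r - s = (2 * n + 1 : ℕ) - r - s by
    push_cast; ring, zpow_sub₀ q_ne_zero, zpow_sub₀ q_ne_zero, zpow_natCast]

lemma invFact_sub_eq_add_one (n : ℕ) (r s : ℤ) : invFact (2 * n + 1 - r - s) =
    (1 - q ^ (2 * n + 1) / q ^ r / q ^ s * q) * invFact (2 * n + 1 - r - s + 1) := by
  rw [invFact_eq, show (2 * n + 1 : ℤ) - r - s + 1 = (2 * n + 1 : ℕ) - r - s + 1 by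
    push_cast; ring, zpow_add₀ q_ne_zero, zpow_sub₀ q_ne_zero, zpow_sub₀ q_ne_zero, zpow_natCast,
    zpow_one]

/-- The form of `rowFactor_eq` that holds in every row. -/
lemma rowFactor_mul_invFact (n : ℕ) {r s : ℤ} (hr : r ≤ 2 * n + 1) (hs : 0 ≤ s) :
    rowFactor n r * invFact (2 * n + 1 - r - s - 1) =
    -(q ^ r)⁻¹ * (1 + q ^ n / q ^ r) * (1 - q ^ (2 * n + 1) / q ^ r) *
      (1 - q * q ^ r) * rowFactor n (r + 1) * invFact (2 * n + 1 - r - s - 1) := by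
  rcases hr.lt_or_eq with h | h
  · rw [← rowFactor_eq n (by omega)]
  · rw [invFact_of_neg (k := 2 * n + 1 - r - s - 1) (by omega), mul_zero, mul_zero]

lemma upper_coeff_top (n : ℕ) (s : ℤ) (hs : s = ((2 * n + 1 : ℕ) : ℤ)) :
    1 - q ^ (2 * n + 1) / q ^ s = 0 := by
  rw [hs, zpow_natCast, div_self (pow_ne_zero _ q_ne_zero), sub_self]

lemma transfer_mul_diagBand (n : ℕ) :
    transfer n * diagBand n = upperBand n * transfer n := by
  have hq := q_ne_zero
  refine kernel_mul_band (fun r s hr hr' hs hs' => ?_) (by simp) (by simp) (fun s _ => ?_) (by simp)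
  · push_cast at hr' hs'
    have h1 := rowFactor_mul_invFact n hr' hs
    have h2 := invFact_sub_eq n r s
    rw [show (2 * n + 1 : ℤ) - (r + 1) - s = 2 * n + 1 - r - s - 1 by ring]
    have hr0 : q ^ r ≠ 0 := zpow_ne_zero _ hq
    have hs0 : q ^ s ≠ 0 := zpow_ne_zero _ hq
    simp only [Pi.zero_apply, zpow_neg]
    have h3 : (q ^ s)⁻¹ * invFact (2 * n + 1 - r - s) = q ^ r / q ^ (2 * n + 1) *
        (invFact (2 * n + 1 - r - s) - invFact (2 * n + 1 - r - s - 1)) := by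
      rw [h2]; field_simp; ring
    linear_combination (rowFactor n r) * h3 - q ^ r / q ^ (2 * n + 1) * h1 +
      (1 + q ^ n / q ^ r) * (1 - q ^ (2 * n + 1) / q ^ r) * (1 - q * q ^ r) / q ^ (2 * n + 1) *
      rowFactor n (r + 1) * invFact (2 * n + 1 - r - s - 1) * (mul_inv_cancel₀ hr0)
  · simp [upper_coeff_top]

lemma transfer_mul_lowerBand (n : ℕ) :
    transfer n * lowerBand n = diagBand n * transfer n := by
  have hq := q_ne_zero
  refine kernel_mul_band (fun r s hr hr' hs hs' => ?_) (by simp) (fun r hr => ?_) (by simp)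
    (by simp)
  · have h2 := invFact_sub_eq n r s
    rw [show (2 * n + 1 : ℤ) - r - (s + 1) = 2 * n + 1 - r - s - 1 by ring, h2]
    have hr0 : q ^ r ≠ 0 := zpow_ne_zero _ hq
    have hs0 : q ^ s ≠ 0 := zpow_ne_zero _ hq
    simp only [Pi.zero_apply, zpow_neg, zpow_add₀ hq, zpow_one]
    field_simp
    ring
  · rw [invFact_of_neg (by push_cast; omega)]; simp

lemma transfer_mul_upperBand (n : ℕ) :
    transfer n * upperBand n = middleBand n * transfer n := by
  have hq := q_ne_zero
  refine kernel_mul_band (fun r s hr hr' hs hs' => ?_) (fun r hr => ?_) (by simp) (fun s _ => ?_)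
    (fun s hs => ?_)
  · push_cast at hr' hs'
    have h1 := rowFactor_mul_invFact n hr' hs
    have h2 := invFact_sub_eq n r s
    have h3 := invFact_sub_eq_add_one n r s
    have h4 := rowFactor_eq n (r := r - 1) (by omega)
    rw [sub_add_cancel, zpow_sub₀ hq, zpow_one] at h4
    rw [show (2 * n + 1 : ℤ) - r - (s - 1) = 2 * n + 1 - r - s + 1 by ring,
      show (2 * n + 1 : ℤ) - (r - 1) - s = 2 * n + 1 - r - s + 1 by ring,
      show (2 * n + 1 : ℤ) - (r + 1) - s = 2 * n + 1 - r - s - 1 by ring, h4]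
    have hr0 : q ^ r ≠ 0 := zpow_ne_zero _ hq
    have hs0 : q ^ s ≠ 0 := zpow_ne_zero _ hq
    have h5 : q * q ^ n * q ^ r / (q ^ (2 * n + 1)) ^ 2 * (1 + q ^ n / q ^ r) *
      (1 - q ^ (2 * n + 1) / q ^ r) * (1 - q * q ^ r) * (rowFactor n (r + 1) *
      invFact (2 * n + 1 - r - s - 1)) = - (q * q ^ n * (q ^ r) ^ 2 / (q ^ (2 * n + 1)) ^ 2) *
      (rowFactor n r * invFact (2 * n + 1 - r - s - 1)) := by
      rw [h1]; field_simp
    rw [h5, h2, h3]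
    simp only [Pi.zero_apply, zpow_sub₀ hq, zpow_one]
    have hQ : q ^ (2 * n + 1) = (q ^ n) ^ 2 * q := by rw [pow_succ, pow_mul']
    rw [hQ]
    field_simp
    ring
  · simp [hq]
  · simp [upper_coeff_top]
  · rw [rowFactor_of_neg n (by norm_num)]; simp

lemma transfer_mul_middleBand (n : ℕ) :
    transfer n * middleBand n = lowerBand n * transfer n := by
  have hq := q_ne_zero
  refine kernel_mul_band (fun r s hr hr' hs hs' => ?_) (fun r hr => ?_) (fun r hr => ?_) (by simp)
    (fun s hs => ?_)
  · push_cast at hr' hs'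
    have h2 := invFact_sub_eq n r s
    have h3 := invFact_sub_eq_add_one n r s
    have h4 := rowFactor_eq n (r := r - 1) (by omega)
    rw [sub_add_cancel, zpow_sub₀ hq, zpow_one] at h4
    rw [show (2 * n + 1 : ℤ) - r - (s - 1) = 2 * n + 1 - r - s + 1 by ring,
      show (2 * n + 1 : ℤ) - (r - 1) - s = 2 * n + 1 - r - s + 1 by ring,
      show (2 * n + 1 : ℤ) - r - (s + 1) = 2 * n + 1 - r - s - 1 by ring, h4, h2, h3]
    have hr0 : q ^ r ≠ 0 := zpow_ne_zero _ hq
    have hs0 : q ^ s ≠ 0 := zpow_ne_zero _ hq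
    simp only [Pi.zero_apply, zpow_sub₀ hq, zpow_add₀ hq, zpow_one]
    have hQ : q ^ (2 * n + 1) = (q ^ n) ^ 2 * q := by rw [pow_succ, pow_mul']
    rw [hQ]
    field_simp
    ring
  · simp [hq]
  · rw [invFact_of_neg (by push_cast; omega)]; simp
  · rw [rowFactor_of_neg n (by norm_num)]; simp

lemma transferInv_mul_diagBand (n : ℕ) :
    transferInv n * diagBand n = lowerBand n * transferInv n := by
  have hq := q_ne_zero
  refine kernel_mul_band (fun s r hs hs' hr hr' => ?_) (by simp) (by simp) (by simp)
    (fun r hr => ?_)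
  · have hr0 : q ^ r ≠ 0 := zpow_ne_zero _ hq
    have hs0 : q ^ s ≠ 0 := zpow_ne_zero _ hq
    have he := rowFactor_ne_zero n hr
    have hz : q ^ (r + s - (2 * n + 1)) = q ^ r * q ^ s / q ^ (2 * n + 1) := by
      rw [zpow_sub₀ hq, zpow_add₀ hq]; norm_cast
    have h1 := gaussWeight_add_one (r + s - (2 * n + 1) - 1)
    have h2 := invFact_eq (r + s - (2 * n + 1) - 1)
    rw [sub_add_cancel, zpow_sub₀ hq, zpow_one, hz] at h1
    rw [sub_add_cancel, hz] at h2
    rw [show r + (s - 1) - (2 * n + 1 : ℤ) = r + s - (2 * n + 1) - 1 by ring, h1, h2]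
    simp only [Pi.zero_apply, zpow_neg]
    field_simp
    ring
  · push_cast at hr
    rw [invFact_of_neg (by omega)]; simp

lemma transfer_mul_transferInv (n : ℕ) : transfer n * transferInv n = 1 := by
  have hc : (transfer n * transferInv n) * diagBand n =
      diagBand n * (transfer n * transferInv n) := by
    rw [mul_assoc, transferInv_mul_diagBand, ← mul_assoc, transfer_mul_lowerBand, mul_assoc]
  ext r s
  by_cases hrs : r = s
  · subst hrs
    rw [Matrix.one_apply_eq, Matrix.mul_apply,
      Finset.sum_eq_single (⟨2 * n + 1 - r, by omega⟩ : Fin (2 * n + 1 + 1))]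
    · have hr := r.is_lt
      have hc : ((2 * n + 1 - (r : ℕ) : ℕ) : ℤ) = 2 * n + 1 - r := by omega
      simp only [transfer, transferInv, kernel, Matrix.of_apply, hc]
      rw [show (2 * n + 1 : ℤ) - r - (2 * n + 1 - r) = 0 by ring,
        show (r : ℤ) + (2 * n + 1 - r) - (2 * n + 1) = 0 by ring, invFact_zero, gaussWeight_zero]
      have := rowFactor_ne_zero n (r := r) (by omega)
      field_simp
    · intro b _ hb
      have hb' : (b : ℤ) ≠ 2 * n + 1 - r := fun h => hb (Fin.ext (by simp; omega))
      simp only [transfer, transferInv, kernel, Matrix.of_apply]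
      rcases lt_or_gt_of_ne hb' with h | h
      · rw [invFact_of_neg (k := r + b - (2 * n + 1)) (by omega)]; simp
      · rw [invFact_of_neg (k := 2 * n + 1 - r - b) (by omega)]; simp
    · simp
  · rw [Matrix.one_apply_ne hrs]
    exact apply_eq_zero_of_commute hc hrs

/-- The scalar to which the fourth power of `transfer` reduces. -/
noncomputable def transferScalar (n : ℕ) : RatFunc ℚ :=
  gaussWeight (2 * n + 1) * (qPochZ (-q) n * qPochZ (-q) (-n - 1)) ^ 2

lemma exists_transfer_pow_four (n : ℕ) :
    ∃ c : RatFunc ℚ, transfer n ^ 4 = c • (1 : Matrix _ _ (RatFunc ℚ)) := by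
  have hc : transfer n ^ 4 * diagBand n = diagBand n * transfer n ^ 4 := by
    have e : transfer n ^ 4 = transfer n * (transfer n * (transfer n * transfer n)) := by
      simp only [pow_succ, pow_zero, one_mul, mul_assoc]
    rw [e]
    simp only [mul_assoc]
    rw [transfer_mul_diagBand, ← mul_assoc (transfer n) (upperBand n), transfer_mul_upperBand,
      mul_assoc (middleBand n), ← mul_assoc (transfer n) (middleBand n), transfer_mul_middleBand,
      mul_assoc (lowerBand n), ← mul_assoc (transfer n) (lowerBand n), transfer_mul_lowerBand,
      mul_assoc (diagBand n)]
  have hoff : ∀ r s, r ≠ s → (transfer n ^ 4) r s = 0 := fun r s h =>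
    apply_eq_zero_of_commute hc h
  have hdiag : transfer n ^ 4 = Matrix.diagonal fun r => (transfer n ^ 4) r r := by
    ext r s
    by_cases h : r = s
    · subst h; simp
    · rw [hoff r s h, Matrix.diagonal_apply_ne _ h]
  refine ⟨(transfer n ^ 4) 0 0, ?_⟩
  have hcomm : transfer n * transfer n ^ 4 = transfer n ^ 4 * transfer n :=
    (pow_succ' _ _).symm.trans (pow_succ _ _)
  ext r s
  by_cases h : r = s
  · subst h
    have h1 := congrFun (congrFun hcomm 0) r
    rw [hdiag, Matrix.mul_diagonal, Matrix.diagonal_mul, mul_comm] at h1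
    have h0 : transfer n 0 r ≠ 0 := by
      simp only [transfer, kernel, Matrix.of_apply]
      exact mul_ne_zero (rowFactor_ne_zero n (by simp)) (invFact_ne_zero (by simp; omega))
    simpa using mul_right_cancel₀ h0 h1
  · simp [hoff r s h, h]

lemma transfer_pow_three (n : ℕ) : transfer n ^ 3 = transferScalar n • transferInv n := by
  obtain ⟨c, hc⟩ := exists_transfer_pow_four n
  have h3 : transfer n ^ 3 = c • transferInv n := by
    calc transfer n ^ 3 = transfer n ^ 3 * (transfer n * transferInv n) := by
          rw [transfer_mul_transferInv, mul_one]
      _ = transfer n ^ 4 * transferInv n := by rw [← mul_assoc, ← pow_succ]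
      _ = c • transferInv n := by rw [hc, smul_mul_assoc, one_mul]
  have h2 : transfer n ^ 2 = c • (transferInv n * transferInv n) := by
    calc transfer n ^ 2 = transfer n ^ 2 * (transfer n * transferInv n) := by
          rw [transfer_mul_transferInv, mul_one]
      _ = transfer n ^ 3 * transferInv n := by rw [← mul_assoc, ← pow_succ]
      _ = c • (transferInv n * transferInv n) := by rw [h3, smul_mul_assoc]
  have he := congrFun (congrFun h2 (Fin.last _)) 0
  have hE0 := rowFactor_ne_zero n (r := 0) le_rfl
  have hEN := rowFactor_ne_zero n (r := 2 * n + 1) (by omega)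
  have hL : (transfer n ^ 2) (Fin.last _) 0 =
      rowFactor n (2 * n + 1) * rowFactor n 0 * invFact (2 * n + 1) := by
    rw [pow_two, Matrix.mul_apply, Finset.sum_eq_single 0]
    · simp [transfer, kernel, invFact_zero]
      ring
    · intro b _ hb
      have hb' : (b : ℕ) ≠ 0 := fun h => hb (Fin.ext h)
      simp only [transfer, kernel, Matrix.of_apply, Fin.val_last]
      rw [invFact_of_neg (k := 2 * n + 1 - ((2 * n + 1 : ℕ) : ℤ) - b) (by push_cast; omega)]
      simp
    · simp
  have hR : (transferInv n * transferInv n) (Fin.last _) 0 =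
      gaussWeight (2 * n + 1) * invFact (2 * n + 1) /
        (rowFactor n (2 * n + 1) * rowFactor n 0) := by
    rw [Matrix.mul_apply, Finset.sum_eq_single (Fin.last _)]
    · simp [transferInv, kernel, invFact_zero, gaussWeight_zero]
      field_simp
    · intro b _ hb
      have hb' : (b : ℕ) ≠ 2 * n + 1 := fun h => hb (Fin.ext h)
      have := b.is_lt
      simp only [transferInv, kernel, Matrix.of_apply, Fin.val_zero]
      rw [invFact_of_neg (k := ((0 : ℕ) : ℤ) + b - (2 * n + 1)) (by push_cast; omega)]
      simp
    · simp
  rw [Matrix.smul_apply, hL, hR, smul_eq_mul] at he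
  have hE : rowFactor n (2 * n + 1) * rowFactor n 0 =
      gaussWeight (2 * n + 1) * (qPochZ (-q) n * qPochZ (-q) (-n - 1)) := by
    have hF := qFact_ne_zero (2 * n + 1)
    rw [rowFactor, rowFactor, show (n : ℤ) - (2 * n + 1) = -n - 1 by ring, sub_self, sub_zero,
      sub_zero, qFact_zero, invFact_zero, gaussWeight_zero,
      invFact_of_nonneg (k := 2 * n + 1) (by omega)]
    field_simp
  have hf : invFact (2 * n + 1) ≠ 0 := invFact_ne_zero (by omega)
  have hg := gaussWeight_ne_zero (2 * n + 1)
  rw [h3]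
  congr 1
  have hE' : (rowFactor n (2 * n + 1) * rowFactor n 0) ^ 2 = c * gaussWeight (2 * n + 1) := by
    field_simp at he
    linear_combination he
  rw [hE] at hE'
  rw [transferScalar]
  refine mul_right_cancel₀ hg ?_
  linear_combination -hE'

lemma transferScalar_add_two (n : ℕ) :
    transferScalar (n + 2) = q ^ (12 * n + 16) * transferScalar n := by
  have hq := q_ne_zero
  have g1 := gaussWeight_add_one (2 * n + 1)
  have g2 := gaussWeight_add_one (2 * n + 1 + 1)
  have g3 := gaussWeight_add_one (2 * n + 1 + 1 + 1)
  have g4 := gaussWeight_add_one (2 * n + 1 + 1 + 1 + 1)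
  have p1 := qPochZ_add_one n
  have p2 := qPochZ_add_one (n + 1)
  have p3 := qPochZ_add_one (-n - 3)
  have p4 := qPochZ_add_one (-n - 3 + 1)
  rw [show -(n : ℤ) - 3 + 1 + 1 = -n - 1 by ring] at p4
  rw [transferScalar, transferScalar, p4, p3, show -((n + 2 : ℕ) : ℤ) - 1 = -n - 3 by
    push_cast; ring, show ((n + 2 : ℕ) : ℤ) = n + 1 + 1 by push_cast; ring, p2, p1,
    show 2 * ((n : ℤ) + 1 + 1) + 1 = 2 * n + 1 + 1 + 1 + 1 + 1 by ring, g4, g3, g2, g1]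
  have e1 : q ^ (2 * n : ℤ) = (q ^ n) ^ 2 := by
    rw [mul_comm, zpow_mul, zpow_natCast, zpow_ofNat]
  have e2 : q ^ (-n - 3 : ℤ) = (q ^ n)⁻¹ * (q ^ 3)⁻¹ := by
    rw [zpow_sub₀ hq, zpow_neg, zpow_natCast, zpow_ofNat, div_eq_mul_inv]
  have e3 : q ^ (-n - 1 : ℤ) = (q ^ n)⁻¹ * q⁻¹ := by
    rw [zpow_sub₀ hq, zpow_neg, zpow_natCast, zpow_one, div_eq_mul_inv]
  have e4 : q ^ (12 * n + 16) = (q ^ n) ^ 12 * q ^ 16 := by rw [pow_add, pow_mul']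
  simp only [zpow_add₀ hq, zpow_one, e1, e2, e3, e4, zpow_natCast]
  field_simp
  ring

lemma Umul_three_eq_trace (n : ℕ) : Umul 3 n = (transfer n ^ 3).trace := by
  have hR : (transfer n ^ 3).trace = ∑ a ∈ range (2 * n + 2), ∑ b ∈ range (2 * n + 2),
      ∑ c ∈ range (2 * n + 2), rowFactor n a * invFact (2 * n + 1 - a - b) *
        (rowFactor n b * invFact (2 * n + 1 - b - c)) *
        (rowFactor n c * invFact (2 * n + 1 - c - a)) := by
    simp only [pow_succ, pow_zero, one_mul, Matrix.trace, Matrix.diag_apply, Matrix.mul_apply,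
      Finset.sum_mul, transfer, kernel, Matrix.of_apply]
    simp only [Finset.sum_range]
    exact Finset.sum_congr rfl fun a _ => Finset.sum_comm
  rw [hR, Umul]
  simp only [← Finset.sum_product']
  refine Finset.sum_nbij' (fun r => (r 0, r 1, r 2)) (fun p => ![p.1, p.2.1, p.2.2]) ?_ ?_ ?_ ?_ ?_
  · intro r hr
    have := Fintype.mem_piFinset.1 hr
    simp only [Finset.mem_product]
    exact ⟨this 0, this 1, this 2⟩
  · intro p hp
    simp only [Finset.mem_product] at hp
    refine Fintype.mem_piFinset.2 fun i => ?_
    fin_cases i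
    exacts [hp.1, hp.2.1, hp.2.2]
  · intro r _
    ext i
    fin_cases i <;> rfl
  · intro p _
    rfl
  · intro r _
    simp only [Fin.prod_univ_three, ← gaussWeight_natCast, qbinom_eq, rowFactor, zero_add,
      show (1 : Fin 3) + 1 = 2 from rfl, show (2 : Fin 3) + 1 = 0 from rfl,
      show ∀ z : ℤ, 2 * (n : ℤ) - z + 1 = 2 * n + 1 - z from fun z => by ring]
    ring

/-- The summand of the trace of `transferInv`, indexed from the last row. -/
noncomputable def traceTerm (n : ℕ) (j : ℤ) : RatFunc ℚ :=
  gaussWeight (2 * n + 1 - 2 * j) * (gaussWeight (2 * n + 1 - j))⁻¹ *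
    (qPochZ (-q) (j - n - 1))⁻¹ * qFact (2 * n + 1 - j) * invFact j * invFact (2 * n + 1 - 2 * j)

lemma trace_transferInv (n : ℕ) :
    (transferInv n).trace = ∑ j ∈ range (2 * n + 2), traceTerm n j := by
  rw [← Finset.sum_range_reflect]
  simp only [Matrix.trace, Matrix.diag_apply, transferInv, kernel, Matrix.of_apply]
  rw [Finset.sum_range]
  refine Finset.sum_congr rfl fun r _ => ?_
  have hr := r.is_lt
  rw [show ((2 * n + 2 - 1 - (r : ℕ) : ℕ) : ℤ) = 2 * n + 1 - r by omega, traceTerm, rowFactor,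
    show (2 * n + 1 : ℤ) - 2 * (2 * n + 1 - r) = r + r - (2 * n + 1) by ring, sub_sub_cancel,
    show (2 * n + 1 : ℤ) - r - n - 1 = n - r by ring, invFact_of_nonneg (k := r) (by omega),
    invFact_of_nonneg (k := 2 * n + 1 - r) (by omega)]
  have := qFact_ne_zero r
  have := qFact_ne_zero (2 * n + 1 - r)
  have := gaussWeight_ne_zero r
  have := qPochZ_ne_zero (n - r)
  field_simp

lemma traceTerm_eq_zero {n : ℕ} {j : ℤ} (hj : n < j) : traceTerm n j = 0 := by
  rw [traceTerm, invFact_of_neg (k := 2 * n + 1 - 2 * j) (by omega), mul_zero]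

lemma sum_traceTerm_of_le {n m : ℕ} (h : n + 1 ≤ m) :
    ∑ j ∈ range m, traceTerm n j = ∑ j ∈ range (n + 1), traceTerm n j := by
  refine (Finset.sum_subset (Finset.range_mono h) fun j _ hj => traceTerm_eq_zero ?_).symm
  have := Finset.mem_range.not.1 hj
  omega

/-- The telescoping certificate for the recurrence of `∑ j, traceTerm n j`. -/
noncomputable def certificate (n : ℕ) (j : ℤ) : RatFunc ℚ :=
  gaussWeight (2 * n + 5 - 2 * j) * (gaussWeight (2 * n + 5 - j))⁻¹ *
    (qPochZ (-q) (j - n - 3))⁻¹ * qFact (2 * n + 2 - j) * invFact (j - 1) *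
    invFact (2 * n + 5 - 2 * j) *
    (-1 + q ^ 5 * (q ^ n) ^ 3 / (q ^ j) ^ 2 + (q ^ 8 + q ^ 9) * (q ^ n) ^ 4 / (q ^ j) ^ 3 -
      q ^ 10 * (q ^ n) ^ 5 / (q ^ j) ^ 4 - q ^ 12 * (q ^ n) ^ 6 / (q ^ j) ^ 4)

lemma inv_qPochZ (k : ℤ) :
    (qPochZ (-q) k)⁻¹ = (1 + q ^ (k + 1)) * (qPochZ (-q) (k + 1))⁻¹ := by
  rw [qPochZ_add_one, mul_inv, mul_inv_cancel_left₀ (one_add_q_zpow_ne_zero _)]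

lemma traceTerm_add_two (n : ℕ) (j : ℤ) (hj : j ≤ 2 * n + 1) :
    traceTerm (n + 2) j + (q ^ (3 * n + 4))⁻¹ * traceTerm n j =
      certificate n (j + 1) - certificate n j := by
  have hq := q_ne_zero
  have hz : q ^ j ≠ 0 := zpow_ne_zero _ hq
  have e1 : ∀ i : ℤ, q ^ (2 * n + i - 2 * j) = (q ^ n) ^ 2 * q ^ i / (q ^ j) ^ 2 := fun i => by
    rw [zpow_sub₀ hq, zpow_add₀ hq, mul_comm 2, zpow_mul, zpow_natCast, mul_comm 2, zpow_mul]
    norm_cast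
  have e2 : ∀ i : ℤ, q ^ (2 * n + i - j) = (q ^ n) ^ 2 * q ^ i / q ^ j := fun i => by
    rw [zpow_sub₀ hq, zpow_add₀ hq, mul_comm 2, zpow_mul, zpow_natCast]
    norm_cast
  have e3 : ∀ i : ℤ, q ^ (j - n - i) = q ^ j / q ^ n / q ^ i := fun i => by
    rw [zpow_sub₀ hq, zpow_sub₀ hq, zpow_natCast]
  have e4 : q ^ (3 * n + 4) = (q ^ n) ^ 3 * q ^ 4 := by rw [pow_add, pow_mul']
  have gA : ∀ i : ℤ, gaussWeight (2 * n + (i + 1) - 2 * j) =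
      -((q ^ n) ^ 2 * q ^ i / (q ^ j) ^ 2) * gaussWeight (2 * n + i - 2 * j) := fun i => by
    rw [← e1, ← gaussWeight_add_one]; congr 1; ring
  have gB : ∀ i : ℤ, gaussWeight (2 * n + (i + 1) - j) =
      -((q ^ n) ^ 2 * q ^ i / q ^ j) * gaussWeight (2 * n + i - j) := fun i => by
    rw [← e2, ← gaussWeight_add_one]; congr 1; ring
  have pA : ∀ i : ℤ, (qPochZ (-q) (j - n - (i + 1)))⁻¹ =
      (1 + q ^ j / q ^ n / q ^ i) * (qPochZ (-q) (j - n - i))⁻¹ := fun i => by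
    rw [inv_qPochZ, ← e3, show j - n - (i + 1) + 1 = j - n - i by ring]
  have fA : ∀ i : ℤ, invFact (2 * n + i - 2 * j) =
      (1 - (q ^ n) ^ 2 * q ^ (i + 1) / (q ^ j) ^ 2) * invFact (2 * n + (i + 1) - 2 * j) :=
    fun i => by
      rw [← e1, invFact_eq, show 2 * n + i - 2 * j + 1 = 2 * n + (i + 1) - 2 * j by ring]
  have qA : ∀ i : ℤ, 1 ≤ i → qFact (2 * n + (i + 1) - j) =
      (1 - (q ^ n) ^ 2 * q ^ (i + 1) / q ^ j) * qFact (2 * n + i - j) := fun i hi => by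
    rw [← e2, ← add_assoc, show (2 * n + i + 1 : ℤ) - j = 2 * n + i - j + 1 by ring,
      qFact_add_one (by omega)]
  have fj : invFact (j - 1) = (1 - q ^ j) * invFact j := by rw [invFact_eq, sub_add_cancel]
  have gA1 := gA 1
  have gA2 := gA 2
  have gA3 := gA 3
  have gA4 := gA 4
  have gB1 := gB 1
  have gB2 := gB 2
  have gB3 := gB 3
  have gB4 := gB 4
  have pA1 := pA 1
  have pA2 := pA 2
  have fA1 := fA 1
  have fA2 := fA 2
  have fA3 := fA 3
  have fA4 := fA 4
  have qA1 := qA 1 (by norm_num)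
  have qA2 := qA 2 (by norm_num)
  have qA3 := qA 3 (by norm_num)
  have qA4 := qA 4 (by norm_num)
  norm_num only at gA1 gA2 gA3 gA4 gB1 gB2 gB3 gB4 pA1 pA2 fA1 fA2 fA3 fA4 qA1 qA2 qA3 qA4
  have hg := gaussWeight_ne_zero (2 * n + 1 - j)
  simp only [traceTerm, certificate]
  rw [show 2 * ((n + 2 : ℕ) : ℤ) + 1 = 2 * n + 5 by push_cast; ring,
    show j - ((n + 2 : ℕ) : ℤ) - 1 = j - n - 3 by push_cast; ring,
    show (2 * n + 5 : ℤ) - 2 * (j + 1) = 2 * n + 3 - 2 * j by ring,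
    show (2 * n + 5 : ℤ) - (j + 1) = 2 * n + 4 - j by ring,
    show (2 * n + 2 : ℤ) - (j + 1) = 2 * n + 1 - j by ring,
    show j + 1 - n - 3 = j - n - 2 by ring, add_sub_cancel_right,
    gA4, gA3, gA2, gA1, gB4, gB3, gB2, gB1, pA2, pA1, fA1, fA2, fA3, fA4, qA4, qA3, qA2, qA1,
    fj, e4, zpow_add₀ hq, zpow_one]
  simp only [zpow_ofNat]
  field_simp
  ring

lemma sum_traceTerm_add_two {n : ℕ} (hn : 1 ≤ n) :
    ∑ j ∈ range (n + 3), traceTerm (n + 2) j =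
      -(q ^ (3 * n + 4))⁻¹ * ∑ j ∈ range (n + 3), traceTerm n j := by
  have h : ∑ j ∈ range (n + 3),
      (traceTerm (n + 2) j + (q ^ (3 * n + 4))⁻¹ * traceTerm n j) = 0 := by
    calc _ = ∑ j ∈ range (n + 3), (certificate n ((j + 1 : ℕ) : ℤ) - certificate n (j : ℤ)) := by
          refine Finset.sum_congr rfl fun j hj => ?_
          have := Finset.mem_range.1 hj
          rw [traceTerm_add_two n j (by omega), Nat.cast_succ]
      _ = certificate n ((n + 3 : ℕ) : ℤ) - certificate n ((0 : ℕ) : ℤ) :=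
          Finset.sum_range_sub (fun j : ℕ => certificate n j) _
      _ = 0 := by
          rw [certificate, certificate,
            invFact_of_neg (k := 2 * n + 5 - 2 * ((n + 3 : ℕ) : ℤ)) (by omega),
            invFact_of_neg (k := ((0 : ℕ) : ℤ) - 1) (by omega)]
          ring
  rw [Finset.sum_add_distrib, ← Finset.mul_sum] at h
  linear_combination h

lemma trace_transferInv_add_two {n : ℕ} (hn : 1 ≤ n) :
    (transferInv (n + 2)).trace = -(q ^ (3 * n + 4))⁻¹ * (transferInv n).trace := by
  rw [trace_transferInv, trace_transferInv, sum_traceTerm_of_le (by omega),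
    sum_traceTerm_add_two hn, sum_traceTerm_of_le (by omega),
    sum_traceTerm_of_le (m := 2 * n + 2) (by omega)]

end QTrace

/-- Lemma 3.2 (second recurrence): `U_3(n+2) = -q^(9n+12) U_3(n)`. -/
theorem U3_recurrence (n : ℕ) (hn : 1 ≤ n) :
    Umul 3 (n + 2) = -(q ^ (9 * n + 12)) * Umul 3 n := by
  rw [QTrace.Umul_three_eq_trace, QTrace.Umul_three_eq_trace, QTrace.transfer_pow_three,
    QTrace.transfer_pow_three, Matrix.trace_smul, Matrix.trace_smul,
    QTrace.trace_transferInv_add_two hn, QTrace.transferScalar_add_two, smul_eq_mul, smul_eq_mul,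
    show 12 * n + 16 = (9 * n + 12) + (3 * n + 4) by ring, pow_add q (9 * n + 12)]
  have := pow_ne_zero (3 * n + 4) QTrace.q_ne_zero
  field_simp
end

section
/- For every integer n ≥ 1, the double sum W_2 satisfies the four-term recurrence in ℚ(q): 0 = -q^{9n+11}(1+q^{n+3}) W_2(n) - q^{6n+10}(1+q^{n+3}) W_2(n+1) + q^{3n+7}(1+q^{n+1}) W_2(n+2) + (1+q^{n+1}) W_2(n+3). -/
open Finset

/-- The Gaussian binomial coefficient on natural numbers, defined by the `q`-Pascal rule. -/
noncomputable def gauss : ℕ → ℕ → RatFunc ℚ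
  | _, 0 => 1
  | 0, _ + 1 => 0
  | n + 1, k + 1 => gauss n k + q ^ (k + 1) * gauss n (k + 1)

@[simp] lemma gauss_zero_right (n : ℕ) : gauss n 0 = 1 := by
  cases n <;> rfl

lemma gauss_succ_succ (n k : ℕ) :
    gauss (n + 1) (k + 1) = gauss n k + q ^ (k + 1) * gauss n (k + 1) := rfl

lemma gauss_eq_zero_of_lt {n k : ℕ} (h : n < k) : gauss n k = 0 := by
  induction n generalizing k with
  | zero => obtain ⟨k, rfl⟩ := Nat.exists_eq_succ_of_ne_zero (by omega : k ≠ 0); rfl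
  | succ n ih =>
    obtain ⟨k, rfl⟩ := Nat.exists_eq_succ_of_ne_zero (by omega : k ≠ 0)
    rw [Nat.succ_eq_add_one, gauss_succ_succ, ih (by omega), ih (by omega)]; simp

@[simp] lemma gauss_self (n : ℕ) : gauss n n = 1 := by
  induction n with
  | zero => rfl
  | succ n ih => rw [gauss_succ_succ, ih, gauss_eq_zero_of_lt (Nat.lt_succ_self n)]; simp

lemma q_ne_zero : q ≠ 0 := RatFunc.X_ne_zero

lemma one_sub_q_pow_ne_zero (k : ℕ) : 1 - q ^ (k + 1) ≠ 0 := by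
  have h : (1 - Polynomial.X ^ (k + 1) : Polynomial ℚ) ≠ 0 := fun h => by
    simpa using congrArg (Polynomial.eval 0) h
  have h' := RatFunc.algebraMap_ne_zero h
  simpa [q] using h'

lemma one_add_q_pow_ne_zero (k : ℕ) : 1 + q ^ k ≠ 0 := by
  have h : (1 + Polynomial.X ^ k : Polynomial ℚ) ≠ 0 := fun h => by
    have := congrArg (Polynomial.eval 1) h
    norm_num at this
  have h' := RatFunc.algebraMap_ne_zero h
  simpa [q] using h'

lemma one_add_q_zpow_ne_zero (z : ℤ) : 1 + q ^ z ≠ 0 := by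
  obtain ⟨k, rfl | rfl⟩ := z.eq_nat_or_neg
  · simpa using one_add_q_pow_ne_zero k
  · intro h
    apply one_add_q_pow_ne_zero k
    have hq : q ^ k ≠ 0 := pow_ne_zero _ q_ne_zero
    rw [zpow_neg, zpow_natCast] at h
    field_simp at h
    linear_combination h

lemma qPoch_succ (a : RatFunc ℚ) (n : ℕ) : qPoch a (n + 1) = qPoch a n * (1 - a * q ^ n) :=
  Finset.prod_range_succ _ _

lemma qPoch_succ' (a : RatFunc ℚ) (n : ℕ) : qPoch a (n + 1) = qPoch (a * q) n * (1 - a) := by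
  simp only [qPoch, Finset.prod_range_succ', pow_zero, mul_one]
  congr 1
  exact Finset.prod_congr rfl fun k _ => by ring

lemma qPoch_q_ne_zero (n : ℕ) : qPoch q n ≠ 0 :=
  Finset.prod_ne_zero_iff.mpr fun k _ => by
    rw [← pow_succ']; exact one_sub_q_pow_ne_zero k

lemma gauss_mul_qPoch (a b : ℕ) :
    gauss (a + b) a * (qPoch q a * qPoch q b) = qPoch q (a + b) := by
  induction a generalizing b with
  | zero => simp [qPoch]
  | succ a iha =>
    induction b with
    | zero => simp [qPoch]
    | succ b ihb =>
      have h := iha (b + 1)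
      rw [show a + 1 + (b + 1) = (a + b + 1) + 1 by ring, gauss_succ_succ,
        qPoch_succ q (a + b + 1)]
      rw [show a + (b + 1) = a + b + 1 by ring] at h
      rw [show a + 1 + b = a + b + 1 by ring] at ihb
      rw [qPoch_succ] at h
      rw [qPoch_succ] at ihb
      rw [qPoch_succ q a, qPoch_succ q b]
      linear_combination (1 - q * q ^ a) * h + q ^ (a + 1) * (1 - q * q ^ b) * ihb

lemma gauss_add_eq_div (a b : ℕ) :
    gauss (a + b) a = qPoch q (a + b) / (qPoch q a * qPoch q b) := by
  rw [eq_div_iff (mul_ne_zero (qPoch_q_ne_zero a) (qPoch_q_ne_zero b)), gauss_mul_qPoch]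

lemma qbinom_natCast (n k : ℕ) : qbinom n k = gauss n k := by
  unfold qbinom
  split_ifs with h
  · obtain ⟨b, rfl⟩ := Nat.exists_eq_add_of_le (by omega : k ≤ n)
    rw [gauss_add_eq_div, ← Nat.cast_sub (Nat.le_add_right k b), Nat.add_sub_cancel_left]
    simp only [Int.toNat_natCast]
  · rw [gauss_eq_zero_of_lt (by omega)]

lemma gauss_symm (a b : ℕ) : gauss (a + b) a = gauss (a + b) b := by
  rw [gauss_add_eq_div, add_comm a b, gauss_add_eq_div, mul_comm]

lemma gauss_succ_succ' {n k : ℕ} (h : k ≤ n) :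
    gauss (n + 1) (k + 1) = gauss n (k + 1) + q ^ (n - k) * gauss n k := by
  obtain ⟨b, rfl⟩ := Nat.exists_eq_add_of_le h
  rw [Nat.add_sub_cancel_left]
  cases b with
  | zero => simp [gauss_eq_zero_of_lt]
  | succ b =>
    rw [show k + (b + 1) + 1 = (k + 1) + (b + 1) by ring, gauss_symm,
      show (k + 1) + (b + 1) = (k + 1 + b) + 1 by ring, gauss_succ_succ,
      ← gauss_symm, show k + 1 + b = k + (b + 1) by ring, gauss_symm k (b + 1)]

/-- The product formula `[M, s] [M - s, j] = [M, s + j] [s + j, s]`. -/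
lemma gauss_mul_gauss (s j b : ℕ) :
    gauss (s + j + b) s * gauss (j + b) j = gauss (s + j + b) (s + j) * gauss (s + j) s := by
  have hs := qPoch_q_ne_zero s
  have hj := qPoch_q_ne_zero j
  have hb := qPoch_q_ne_zero b
  have hsj := qPoch_q_ne_zero (s + j)
  have hjb := qPoch_q_ne_zero (j + b)
  rw [gauss_add_eq_div (s + j) b, gauss_add_eq_div s j, gauss_add_eq_div j b, add_assoc,
    gauss_add_eq_div s (j + b)]
  field_simp

lemma choose_two_succ (n : ℕ) : (n + 1).choose 2 = n + n.choose 2 := by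
  rw [Nat.choose_succ_succ' n 1, Nat.choose_one_right]

lemma choose_two_add (a b : ℕ) : (a + b).choose 2 = a.choose 2 + b.choose 2 + a * b := by
  induction b with
  | zero => simp
  | succ b ih => rw [← add_assoc, choose_two_succ, choose_two_succ, ih]; ring

/-- The homogeneous `q`-binomial theorem. -/
lemma prod_mul_q_pow_add (a y : RatFunc ℚ) (M : ℕ) :
    ∏ i ∈ range M, (a * q ^ i + y) =
      ∑ j ∈ range (M + 1), q ^ j.choose 2 * a ^ j * y ^ (M - j) * gauss M j := by
  induction M with
  | zero => simp
  | succ M ih =>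
    have hy : ∑ j ∈ range (M + 2), q ^ j.choose 2 * a ^ j * y ^ (M + 1 - j) * gauss M j =
        y * ∑ j ∈ range (M + 1), q ^ j.choose 2 * a ^ j * y ^ (M - j) * gauss M j := by
      rw [sum_range_succ, gauss_eq_zero_of_lt (Nat.lt_succ_self M), mul_zero, add_zero, mul_sum]
      refine sum_congr rfl fun j hj => ?_
      rw [Nat.sub_add_comm (Nat.lt_succ_iff.mp (mem_range.mp hj))]
      ring
    have ha : ∑ j ∈ range (M + 1), q ^ (j + 1).choose 2 * a ^ (j + 1) * y ^ (M + 1 - (j + 1)) *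
          (q ^ (M - j) * gauss M j) =
        a * q ^ M * ∑ j ∈ range (M + 1), q ^ j.choose 2 * a ^ j * y ^ (M - j) * gauss M j := by
      rw [mul_sum]
      refine sum_congr rfl fun j hj => ?_
      obtain ⟨b, rfl⟩ := Nat.exists_eq_add_of_le (Nat.lt_succ_iff.mp (mem_range.mp hj))
      rw [choose_two_succ, Nat.add_sub_add_right, Nat.add_sub_cancel_left]
      ring
    rw [prod_range_succ, ih, mul_add, mul_comm _ y, ← hy, mul_comm _ (a * q ^ M), ← ha,
      sum_range_succ' _ (M + 1), sum_range_succ' _ (M + 1), ← add_assoc, ← sum_add_distrib]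
    simp only [gauss_zero_right, add_left_inj]
    refine (sum_congr rfl fun j hj => ?_).symm
    rw [gauss_succ_succ' (Nat.lt_succ_iff.mp (mem_range.mp hj))]
    ring

/-- A `q`-Chu–Vandermonde sum. -/
lemma sum_neg_one_pow_gauss_mul_gauss (r k M : ℕ) (h : k ≤ M) :
    ∑ s ∈ range (k + 1), (-1) ^ s * q ^ s.choose 2 * gauss k s * gauss (M + r - s) r =
      q ^ (M * k) * gauss (M + r - k) M := by
  induction k generalizing M with
  | zero => simp [gauss_symm]
  | succ k ih =>
    obtain ⟨M, rfl⟩ := Nat.exists_eq_succ_of_ne_zero (by omega : M ≠ 0)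
    have h0 := ih (M + 1) (by omega)
    have h1 := ih M (by omega)
    have e0 : ∑ s ∈ range (k + 2), (-1) ^ s * q ^ s.choose 2 * gauss k s *
        gauss (M + 1 + r - s) r = q ^ ((M + 1) * k) * gauss (M + 1 + r - k) (M + 1) := by
      rw [sum_range_succ, gauss_eq_zero_of_lt (Nat.lt_succ_self k), h0]; simp
    have e1 : ∑ s ∈ range (k + 1), (-1) ^ (s + 1) * q ^ (s + 1).choose 2 *
        (q ^ (k - s) * gauss k s) * gauss (M + 1 + r - (s + 1)) r =
        -q ^ k * (q ^ (M * k) * gauss (M + r - k) M) := by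
      rw [← h1, mul_sum]
      refine sum_congr rfl fun s hs => ?_
      obtain ⟨b, rfl⟩ := Nat.exists_eq_add_of_le (Nat.lt_succ_iff.mp (mem_range.mp hs))
      rw [choose_two_succ, Nat.add_sub_cancel_left,
        show M + 1 + r - (s + 1) = M + r - s by omega]
      ring
    have hp : gauss (M + 1 + r - k) (M + 1) =
        gauss (M + r - k) M + q ^ (M + 1) * gauss (M + r - k) (M + 1) := by
      rw [show M + 1 + r - k = M + r - k + 1 by omega, gauss_succ_succ]
    rw [Nat.succ_eq_add_one, show M + 1 + r - (k + 1) = M + r - k by omega]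
    rw [sum_range_succ'] at e0 ⊢
    have : ∑ s ∈ range (k + 1), (-1) ^ (s + 1) * q ^ (s + 1).choose 2 * gauss (k + 1) (s + 1) *
        gauss (M + 1 + r - (s + 1)) r =
        ∑ s ∈ range (k + 1), (-1) ^ (s + 1) * q ^ (s + 1).choose 2 * gauss k (s + 1) *
          gauss (M + 1 + r - (s + 1)) r +
        ∑ s ∈ range (k + 1), (-1) ^ (s + 1) * q ^ (s + 1).choose 2 *
          (q ^ (k - s) * gauss k s) * gauss (M + 1 + r - (s + 1)) r := by
      rw [← sum_add_distrib]
      refine sum_congr rfl fun s hs => ?_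
      rw [gauss_succ_succ' (Nat.lt_succ_iff.mp (mem_range.mp hs))]
      ring
    rw [this, e1]
    simp only [gauss_zero_right] at e0 ⊢
    linear_combination e0 + q ^ ((M + 1) * k) * hp

/-- A terminating form of the transformation from `₂φ₂` to `₂φ₁`. -/
lemma sum_prod_mul_gauss_mul_gauss (y : RatFunc ℚ) (M r : ℕ) :
    ∑ s ∈ range (M + 1), (-1) ^ s * q ^ (2 * s.choose 2) *
        (∏ i ∈ range (M - s), (q ^ s * q ^ i + y)) * gauss M s * gauss (M + r - s) r =
      ∑ k ∈ range (M + 1), q ^ (k.choose 2 + M * k) * y ^ (M - k) * gauss M k *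
        gauss (M + r - k) M := by
  have hL : ∀ s ∈ range (M + 1), (-1) ^ s * q ^ (2 * s.choose 2) *
        (∏ i ∈ range (M - s), (q ^ s * q ^ i + y)) * gauss M s * gauss (M + r - s) r =
      ∑ j ∈ range (M + 1 - s), (-1) ^ s * q ^ ((s + j).choose 2 + s.choose 2) *
        y ^ (M - (s + j)) * gauss M (s + j) * gauss (s + j) s * gauss (M + r - s) r := by
    intro s hs
    have hsM := Nat.lt_succ_iff.mp (mem_range.mp hs)
    rw [prod_mul_q_pow_add, mul_sum, sum_mul, sum_mul, Nat.succ_sub hsM]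
    refine sum_congr rfl fun j hj => ?_
    have hj := Nat.lt_succ_iff.mp (mem_range.mp hj)
    obtain ⟨b, rfl⟩ := Nat.exists_eq_add_of_le (by omega : s + j ≤ M)
    have hg := gauss_mul_gauss s j b
    rw [show s + j + b - s = j + b by omega, Nat.add_sub_cancel_left, Nat.add_sub_cancel_left,
      choose_two_add]
    linear_combination (-1) ^ s * q ^ (2 * s.choose 2 + j.choose 2 + s * j) * y ^ b *
      gauss (s + j + b + r - s) r * hg
  rw [sum_congr rfl hL, ← Finset.sum_range_diag_flip (M + 1) fun s j =>
    (-1) ^ s * q ^ ((s + j).choose 2 + s.choose 2) *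
        y ^ (M - (s + j)) * gauss M (s + j) * gauss (s + j) s * gauss (M + r - s) r]
  refine sum_congr rfl fun k hk => ?_
  have hV := sum_neg_one_pow_gauss_mul_gauss r k M (Nat.lt_succ_iff.mp (mem_range.mp hk))
  have : q ^ (k.choose 2 + M * k) * y ^ (M - k) * gauss M k * gauss (M + r - k) M =
      q ^ k.choose 2 * y ^ (M - k) * gauss M k * (q ^ (M * k) * gauss (M + r - k) M) := by ring
  rw [this, ← hV, mul_sum]
  refine sum_congr rfl fun s hs => ?_
  rw [Nat.add_sub_cancel' (Nat.lt_succ_iff.mp (mem_range.mp hs))]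
  ring

lemma qPochZ_neg_q_eq (z : ℤ) : qPochZ (-q) z = qPochZ (-q) (z - 1) * (1 + q ^ z) := by
  rcases lt_or_ge 0 z with hz | hz
  · obtain ⟨k, rfl⟩ : ∃ k : ℕ, z = k + 1 := ⟨(z - 1).toNat, by omega⟩
    have h1 : ((k : ℤ) + 1).toNat = k + 1 := by omega
    rw [qPochZ, qPochZ, if_pos (by omega), if_pos (by omega), h1, qPoch_succ,
      add_sub_cancel_right, Int.toNat_natCast]
    congr 1
    rw [zpow_add_one₀ q_ne_zero, zpow_natCast]
    ring
  · have key : qPochZ (-q) z = 1 / qPoch (-q * q ^ z) (-z).toNat := by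
      rcases hz.lt_or_eq with h | rfl
      · rw [qPochZ, if_neg (by omega)]
      · simp [qPochZ, qPoch]
    have e : -q * q ^ (z - 1) = -q ^ z := by
      rw [zpow_sub_one₀ q_ne_zero]; field_simp [q_ne_zero]
    have h1 := one_add_q_zpow_ne_zero z
    rw [key, qPochZ, if_neg (by omega), show (-(z - 1)).toNat = (-z).toNat + 1 by omega,
      qPoch_succ', e, sub_neg_eq_add, show -q ^ z * q = -q * q ^ z by ring]
    rw [one_div, one_div, mul_inv, mul_assoc, inv_mul_cancel₀ h1, mul_one]

/-- The denominator `∏_{i < r} (q^i + q^n)`. -/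
noncomputable def qDen (n r : ℕ) : RatFunc ℚ := ∏ i ∈ range r, (q ^ i + q ^ n)

lemma q_pow_add_q_pow_ne_zero (i n : ℕ) : q ^ i + q ^ n ≠ 0 := by
  rcases le_total i n with h | h <;> obtain ⟨b, rfl⟩ := Nat.exists_eq_add_of_le h
  · rw [pow_add, show q ^ i + q ^ i * q ^ b = q ^ i * (1 + q ^ b) by ring]
    exact mul_ne_zero (pow_ne_zero _ q_ne_zero) (one_add_q_pow_ne_zero b)
  · rw [pow_add, show q ^ n * q ^ b + q ^ n = q ^ n * (1 + q ^ b) by ring]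
    exact mul_ne_zero (pow_ne_zero _ q_ne_zero) (one_add_q_pow_ne_zero b)

lemma qDen_ne_zero (n r : ℕ) : qDen n r ≠ 0 :=
  Finset.prod_ne_zero_iff.mpr fun i _ => q_pow_add_q_pow_ne_zero i n

lemma qDen_succ (n r : ℕ) : qDen n (r + 1) = qDen n r * (q ^ r + q ^ n) :=
  Finset.prod_range_succ _ _

lemma qPochZ_mul_qDen (n r : ℕ) :
    qPochZ (-q) ((n : ℤ) - r) * qDen n r = q ^ r.choose 2 * qPoch (-q) n := by
  induction r with
  | zero => simp [qPochZ, qDen]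
  | succ r ih =>
    have h := qPochZ_neg_q_eq ((n : ℤ) - r)
    have hz : q ^ r * q ^ ((n : ℤ) - r) = q ^ n := by
      rw [← zpow_natCast, ← zpow_add₀ q_ne_zero, ← zpow_natCast]; congr 1; ring
    rw [qDen_succ, choose_two_succ, Nat.cast_succ, ← sub_sub, pow_add, mul_assoc, ← ih, h, ← hz]
    ring

lemma qPochZ_eq_div (n r : ℕ) :
    qPochZ (-q) ((n : ℤ) - r) = q ^ r.choose 2 * qPoch (-q) n / qDen n r := by
  rw [eq_div_iff (qDen_ne_zero n r), qPochZ_mul_qDen]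

lemma qDen_add (n s b : ℕ) :
    qDen n (s + b) = qDen n s * ∏ i ∈ range b, (q ^ s * q ^ i + q ^ n) := by
  simp only [qDen, prod_range_add, pow_add]

lemma qDen_self (n : ℕ) : qDen n n = q ^ n.choose 2 * qPoch (-q) n := by
  have h := qPochZ_mul_qDen n n
  simpa [qPochZ, qPoch] using h

lemma one_add_mul_qDen_two_mul (n : ℕ) :
    (1 + q ^ n) * qDen n (2 * n) = 2 * q ^ (n.choose 2 + n * n) * qPoch (-q) n ^ 2 := by
  have h1 : ∏ i ∈ range n, (q ^ n * q ^ i + q ^ n) = q ^ (n * n) * ∏ i ∈ range n, (1 + q ^ i) := by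
    calc _ = ∏ i ∈ range n, q ^ n * (1 + q ^ i) := prod_congr rfl fun i _ => by ring
      _ = _ := by rw [prod_mul_distrib, prod_const, card_range, pow_mul]
  have h2 : (∏ i ∈ range n, (1 + q ^ i)) * (1 + q ^ n) = 2 * qPoch (-q) n := by
    rw [← prod_range_succ (fun i => 1 + q ^ i), prod_range_succ', qPoch, pow_zero, mul_comm]
    congr 1
    · norm_num
    · exact prod_congr rfl fun i _ => by ring
  rw [two_mul, qDen_add, qDen_self, h1]
  linear_combination q ^ (n.choose 2 + n * n) * qPoch (-q) n * h2

lemma qDen_mul_qDen (n r t : ℕ) (h : r + t = 2 * n) :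
    q ^ (n * r) * (q ^ n + q ^ r) * (qDen n r * qDen n t) =
      2 * q ^ (r.choose 2 + r + n.choose 2 + n * n) * qPoch (-q) n ^ 2 := by
  induction r generalizing t with
  | zero =>
    obtain rfl : t = 2 * n := by omega
    have := one_add_mul_qDen_two_mul n
    simp only [mul_zero, pow_zero, qDen, range_zero, prod_empty] at this ⊢
    simp only [Nat.choose_zero_succ, zero_add]
    linear_combination this
  | succ r ih =>
    have hr := ih (t + 1) (by omega)
    rw [qDen_succ] at hr ⊢
    apply mul_right_cancel₀ (pow_ne_zero t q_ne_zero)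
    have e : q ^ r * q * q ^ t = q ^ n * q ^ n := by
      rw [← pow_succ, ← pow_add, ← pow_add]; congr 1; omega
    have e' : q ^ (n * (r + 1)) * (q ^ n + q ^ (r + 1)) * q ^ t =
        q ^ (n * r) * (q ^ n * (q ^ n * (q ^ t + q ^ n))) := by
      rw [mul_add n, pow_add]; linear_combination q ^ (n * r) * q ^ n * e
    rw [choose_two_succ]
    have e2 : q ^ (r + r.choose 2 + (r + 1) + n.choose 2 + n * n) * q ^ t =
        q ^ (r.choose 2 + r + n.choose 2 + n * n) * (q ^ n * q ^ n) := by
      rw [← e]; ring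
    linear_combination (qDen n r * (q ^ r + q ^ n) * qDen n t) * e' +
      q ^ n * q ^ n * hr - 2 * qPoch (-q) n ^ 2 * e2

/-- The sum over the second index in `W_2(n)`, for a fixed first index `r`. -/
lemma sum_row (n r M : ℕ) (h : r + M = 2 * n) :
    ∑ s ∈ range (2 * n + 1), (-1) ^ s * q ^ s.choose 2 * qPochZ (-q) ((n : ℤ) - s) *
        gauss M s * gauss (2 * n - s) r =
      qPoch (-q) n / qDen n M * ∑ k ∈ range (2 * n + 1), q ^ (k.choose 2 + M * k) *
        (q ^ n) ^ (M - k) * gauss M k * gauss (2 * n - k) M := by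
  have restrict : ∀ f : ℕ → RatFunc ℚ, (∀ s, M < s → f s = 0) →
      ∑ s ∈ range (2 * n + 1), f s = ∑ s ∈ range (M + 1), f s := fun f hf =>
    (sum_subset (range_mono (by omega)) fun s _ hs => hf s (by simpa using hs)).symm
  rw [restrict _ fun s hs => by simp [gauss_eq_zero_of_lt hs],
    restrict _ fun s hs => by simp [gauss_eq_zero_of_lt hs]]
  have key := sum_prod_mul_gauss_mul_gauss (q ^ n) M r
  rw [show M + r = 2 * n by omega] at key
  rw [← key, mul_sum]
  refine sum_congr rfl fun s hs => ?_
  obtain ⟨b, rfl⟩ := Nat.exists_eq_add_of_le (Nat.lt_succ_iff.mp (mem_range.mp hs))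
  have h1 := qDen_ne_zero n (s + b)
  have h2 := qDen_ne_zero n s
  rw [qPochZ_eq_div, Nat.add_sub_cancel_left]
  rw [qDen_add] at h1 ⊢
  have h3 := right_ne_zero_of_mul h1
  field_simp
  ring

/-- The summand left in `2 q^{n(3n-1)/2} W_2(n)` once each row has been transformed. -/
noncomputable def rowTerm (n r k : ℕ) : RatFunc ℚ :=
  (-1) ^ r * q ^ (r.choose 2 + n * r) * ((q ^ n + q ^ r) / q ^ r) *
    (q ^ (k.choose 2 + (2 * n - r) * k) * (q ^ n) ^ (2 * n - r - k) * gauss (2 * n - r) k *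
      gauss (2 * n - k) (2 * n - r))

lemma Wmul_two (n : ℕ) :
    Wmul 2 n = ∑ r ∈ range (2 * n + 1), (-1) ^ r * q ^ r.choose 2 * qPochZ (-q) ((n : ℤ) - r) *
      ∑ s ∈ range (2 * n + 1), (-1) ^ s * q ^ s.choose 2 * qPochZ (-q) ((n : ℤ) - s) *
        gauss (2 * n - r) s * gauss (2 * n - s) r := by
  have e : Wmul 2 n = ∑ p ∈ range (2 * n + 1) ×ˢ range (2 * n + 1),
      ((-1 : RatFunc ℚ) ^ p.1 * q ^ (p.1 * (p.1 - 1) / 2) *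
        qPochZ (-q) ((n : ℤ) - p.1) * qbinom (2 * (n : ℤ) - p.1) p.2) *
      ((-1 : RatFunc ℚ) ^ p.2 * q ^ (p.2 * (p.2 - 1) / 2) *
        qPochZ (-q) ((n : ℤ) - p.2) * qbinom (2 * (n : ℤ) - p.2) p.1) := by
    refine sum_bij' (fun r _ => (r 0, r 1)) (fun p _ => ![p.1, p.2]) ?_ ?_ ?_ ?_ ?_
    · intro r hr
      have := Fintype.mem_piFinset.mp hr
      exact mem_product.mpr ⟨this 0, this 1⟩
    · intro p hp
      rw [Fintype.mem_piFinset]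
      intro i
      have := mem_product.mp hp
      fin_cases i
      · exact this.1
      · exact this.2
    · intro r _
      ext i
      fin_cases i <;> rfl
    · intro p _
      rfl
    · intro r _
      rw [Fin.prod_univ_two]
      rfl
  rw [e, sum_product]
  refine sum_congr rfl fun r hr => ?_
  rw [mul_sum]
  refine sum_congr rfl fun s hs => ?_
  have hcast : ∀ t ∈ range (2 * n + 1), 2 * (n : ℤ) - t = ((2 * n - t : ℕ) : ℤ) := fun t ht => by
    have := mem_range.mp ht
    omega
  simp only [hcast r hr, hcast s hs, qbinom_natCast, Nat.choose_two_right]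
  ring

lemma two_mul_Wmul_two (n : ℕ) :
    2 * q ^ (n.choose 2 + n * n) * Wmul 2 n =
      ∑ k ∈ range (2 * n + 1), ∑ r ∈ range (2 * n + 1), rowTerm n r k := by
  rw [Wmul_two, sum_comm, mul_sum]
  refine sum_congr rfl fun r hr => ?_
  have hr' : r + (2 * n - r) = 2 * n := by have := mem_range.mp hr; omega
  rw [sum_row n r (2 * n - r) hr']
  simp only [rowTerm]
  rw [← mul_sum]
  have h1 := qDen_ne_zero n r
  have h2 := qDen_ne_zero n (2 * n - r)
  have hq : q ^ r ≠ 0 := pow_ne_zero _ q_ne_zero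
  have hd := qDen_mul_qDen n r (2 * n - r) hr'
  have hc : q ^ (r.choose 2) ≠ 0 := pow_ne_zero _ q_ne_zero
  rw [qPochZ_eq_div, ← mul_assoc, ← mul_assoc]
  congr 1
  field_simp
  linear_combination -(q ^ r.choose 2) * hd

lemma rowTerm_shift (k m i b : ℕ) (h : i + b = 2 * m) :
    rowTerm (k + m) (k + i) k =
      (-1) ^ k * q ^ (2 * k.choose 2 + k * k + (k + m) * k + 2 * m * (2 * k + m)) *
        gauss (2 * m + k) k *
        ((-1) ^ i * q ^ i.choose 2 * gauss (2 * m) i * (1 + q ^ b / q ^ m)) := by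
  have hM : 2 * (k + m) - (k + i) = k + b := by omega
  have hN : 2 * (k + m) - k = k + b + i := by omega
  have hg := gauss_mul_gauss k b i
  have hqm : q ^ m ≠ 0 := pow_ne_zero _ q_ne_zero
  have hqi : q ^ (k + i) ≠ 0 := pow_ne_zero _ q_ne_zero
  have hfrac : (q ^ (k + m) + q ^ (k + i)) / q ^ (k + i) = 1 + q ^ b / q ^ m := by
    have e : q ^ m * q ^ m = q ^ i * q ^ b := by
      rw [← pow_add, ← pow_add, h, two_mul]
    rw [div_eq_iff hqi]
    field_simp
    rw [pow_add, pow_add]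
    linear_combination q ^ k * e
  have hpow : q ^ ((k + i).choose 2 + (k + m) * (k + i)) *
      (q ^ (k.choose 2 + (k + b) * k) * (q ^ (k + m)) ^ b) =
      q ^ (2 * k.choose 2 + k * k + (k + m) * k + 2 * m * (2 * k + m)) * q ^ i.choose 2 := by
    rw [← h, choose_two_add, ← pow_mul, ← pow_add, ← pow_add, ← pow_add]
    congr 1
    ring
  rw [rowTerm, hM, hN, Nat.add_sub_cancel_left, hfrac, show 2 * m + k = k + b + i by omega,
    show 2 * m = b + i by omega, ← gauss_symm b i, pow_add (-1 : RatFunc ℚ)]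
  rw [show 2 * m = b + i by omega] at hpow
  linear_combination (-1) ^ k * (-1) ^ i * (1 + q ^ b / q ^ m) *
    (gauss (k + b) k * gauss (k + b + i) (k + b) * hpow - q ^ (2 * k.choose 2 + k * k +
      (k + m) * k + (b + i) * (2 * k + m)) * q ^ i.choose 2 * hg)

lemma sum_neg_one_pow_gauss_eq_zero (m : ℕ) :
    ∑ i ∈ range (2 * (m + 1) + 1), (-1) ^ i * q ^ i.choose 2 * gauss (2 * (m + 1)) i *
      (1 + q ^ (2 * (m + 1) - i) / q ^ (m + 1)) = 0 := by
  have h1 := prod_mul_q_pow_add (-1) 1 (2 * (m + 1))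
  have h2 := prod_mul_q_pow_add (-1) q (2 * (m + 1))
  rw [prod_eq_zero (mem_range.mpr (by omega : 0 < 2 * (m + 1))) (by simp)] at h1
  rw [prod_eq_zero (mem_range.mpr (by omega : 1 < 2 * (m + 1))) (by simp)] at h2
  calc _ = ∑ j ∈ range (2 * (m + 1) + 1), q ^ j.choose 2 * (-1) ^ j * 1 ^ (2 * (m + 1) - j) *
          gauss (2 * (m + 1)) j + (∑ j ∈ range (2 * (m + 1) + 1), q ^ j.choose 2 * (-1) ^ j *
          q ^ (2 * (m + 1) - j) * gauss (2 * (m + 1)) j) / q ^ (m + 1) := by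
        rw [sum_div, ← sum_add_distrib]
        refine sum_congr rfl fun j _ => ?_
        rw [one_pow]
        ring
    _ = 0 := by rw [← h1, ← h2]; simp

lemma rowTerm_eq_zero_of_lt {n r k : ℕ} (h : r < k) (hk : k ≤ 2 * n) : rowTerm n r k = 0 := by
  rw [rowTerm, gauss_eq_zero_of_lt (by omega : 2 * n - k < 2 * n - r)]
  simp

lemma rowTerm_eq_zero_of_lt_add {n r k : ℕ} (h : 2 * n - r < k) : rowTerm n r k = 0 := by
  rw [rowTerm, gauss_eq_zero_of_lt h]
  simp

lemma sum_rowTerm_eq_zero {n k : ℕ} (hk : k < n) :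
    ∑ r ∈ range (2 * n + 1), rowTerm n r k = 0 := by
  obtain ⟨m, rfl⟩ := Nat.exists_eq_add_of_lt hk
  rw [show 2 * (k + m + 1) + 1 = k + ((2 * (m + 1) + 1) + k) by ring, sum_range_add,
    sum_range_add, sum_eq_zero fun r hr =>
      rowTerm_eq_zero_of_lt (mem_range.mp hr) (by omega), zero_add]
  rw [sum_eq_zero (s := range k) fun r hr =>
    rowTerm_eq_zero_of_lt_add (by have := mem_range.mp hr; omega), add_zero, add_assoc]
  rw [sum_congr rfl fun i hi => rowTerm_shift k (m + 1) i (2 * (m + 1) - i)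
    (by have := mem_range.mp hi; omega), ← mul_sum, sum_neg_one_pow_gauss_eq_zero, mul_zero]

/-- Closed form of `W_2`. -/
lemma Wmul_two_eq (n : ℕ) : Wmul 2 n = (-1) ^ n * q ^ (n.choose 2 + n * n) := by
  have h := two_mul_Wmul_two n
  rw [sum_eq_single_of_mem n (mem_range.mpr (by omega)), sum_eq_single_of_mem n
    (mem_range.mpr (by omega))] at h
  · have hs := rowTerm_shift n 0 0 0 rfl
    simp only [add_zero] at hs
    rw [hs] at h
    apply mul_left_cancel₀ (mul_ne_zero two_ne_zero
      (pow_ne_zero (n.choose 2 + n * n) q_ne_zero))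
    rw [h]
    simp
    ring
  · intro r hr hne
    rcases hne.lt_or_gt with h' | h'
    · exact rowTerm_eq_zero_of_lt h' (by omega)
    · exact rowTerm_eq_zero_of_lt_add (by have := mem_range.mp hr; omega)
  · intro k hk hne
    rcases hne.lt_or_gt with h' | h'
    · exact sum_rowTerm_eq_zero h'
    · refine sum_eq_zero fun r _ => ?_
      rcases lt_or_ge r k with h'' | h''
      · exact rowTerm_eq_zero_of_lt h'' (by have := mem_range.mp hk; omega)
      · exact rowTerm_eq_zero_of_lt_add (by omega)

/-- Lemma 3.2 (third recurrence): the four-term recurrence for `W_2`. -/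
theorem W2_recurrence (n : ℕ) (hn : 1 ≤ n) :
    0 = -(q ^ (9 * n + 11)) * (1 + q ^ (n + 3)) * Wmul 2 n
      - q ^ (6 * n + 10) * (1 + q ^ (n + 3)) * Wmul 2 (n + 1)
      + q ^ (3 * n + 7) * (1 + q ^ (n + 1)) * Wmul 2 (n + 2)
      + (1 + q ^ (n + 1)) * Wmul 2 (n + 3) := by
  have e0 := Wmul_two_eq n
  have e1 := Wmul_two_eq (n + 1)
  have e2 := Wmul_two_eq (n + 2)
  have e3 := Wmul_two_eq (n + 3)
  simp only [choose_two_succ] at e1 e2 e3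
  rw [e0, e1, e2, e3]
  ring
end

section
/- For every integer n ≥ 1, the triple sum W_3 satisfies the five-term recurrence in ℚ(q): 0 = -q^{15n+24}(1+q^{n+2})(-1+q^{n+3})(1+q^{n+3})(1+q^{n+4})(-1 - 2q^{n+2} + q^{n+3}) W_3(n) - q^{11n+23}(1+q^{n+3})(1+q^{n+4})·(-1 + q - 2q^{n+2} - 2q^{n+3} + 2q^{n+4} - 6q^{2n+4} + 6q^{2n+5} - q^{2n+6} - q^{2n+7} + 2q^{3n+7} + 3q^{3n+8} - 2q^{3n+9} - q^{3n+10} + 5q^{4n+9} - 2q^{4n+10} - 3q^{4n+11} + 2q^{4n+12} - 2q^{5n+12} + 2q^{5n+13}) W_3(n+1) + q^{6n+18}(1+q^{n+1})(1+q^{n+4})(-1+q^{2n+5})·(1 + 2q^{n+1} - q^{n+3} + 7q^{2n+3} - 6q^{2n+4} - 2q^{2n+5} + q^{2n+6} + 2q^{3n+6} - q^{3n+8} + q^{4n+10}) W_3(n+2) + q^{2n+8}(1+q^{n+1})(1+q^{n+2})·(-2 + 2q + 5q^{n+2} - 2q^{n+3} - 3q^{n+4} + 2q^{n+5} + 2q^{2n+5}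 + 3q^{2n+6} - 2q^{2n+7} - q^{2n+8} - 6q^{3n+7} + 6q^{3n+8} - q^{3n+9} - q^{3n+10} - 2q^{4n+10} - 2q^{4n+11} + 2q^{4n+12} - q^{5n+13} + q^{5n+14}) W_3(n+3) + (1+q^{n+1})(-1+q^{n+2})(1+q^{n+2})(1+q^{n+3})(2 - q + q^{n+3}) W_3(n+4). -/
open Finset

namespace CarlitzSum

lemma q_ne_zero : q ≠ 0 := RatFunc.X_ne_zero

lemma q_zpow_two_mul (m : ℤ) : q ^ (2 * m) = q ^ m * q ^ m := by
  rw [two_mul, zpow_add₀ q_ne_zero]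

lemma q_pow_ne_one {k : ℕ} (hk : k ≠ 0) : q ^ k ≠ 1 := by
  intro h
  have h' : (Polynomial.X ^ k : Polynomial ℚ) = 1 := by
    apply RatFunc.algebraMap_injective ℚ
    simpa [q] using h
  have := congrArg Polynomial.natDegree h'
  simp at this
  exact hk this

lemma q_zpow_ne_one {m : ℤ} (hm : m ≠ 0) : q ^ m ≠ 1 := by
  obtain ⟨k, rfl | rfl⟩ := m.eq_nat_or_neg
  · rw [zpow_natCast]
    exact q_pow_ne_one (by simpa using hm)
  · rw [zpow_neg, zpow_natCast, ne_eq, inv_eq_one]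
    exact q_pow_ne_one (by simpa using hm)

lemma one_sub_q_zpow_ne_zero {m : ℤ} (hm : m ≠ 0) : 1 - q ^ m ≠ 0 :=
  sub_ne_zero.2 (q_zpow_ne_one hm).symm

lemma one_add_q_zpow_ne_zero (m : ℤ) : 1 + q ^ m ≠ 0 := by
  intro h
  rcases eq_or_ne m 0 with rfl | hm
  · norm_num at h
  · apply q_zpow_ne_one (m := m + m) (by omega)
    rw [zpow_add₀ q_ne_zero, eq_neg_of_add_eq_zero_right h]
    ring

/-- The symbol `(-q; q)_m` for an integer `m`. -/
noncomputable def negPoch (m : ℤ) : RatFunc ℚ := qPochZ (-q) m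

lemma negPoch_zero : negPoch 0 = 1 := by
  simp [negPoch, qPochZ, qPoch]

lemma negPoch_succ (m : ℤ) : negPoch m = negPoch (m - 1) * (1 + q ^ m) := by
  obtain ⟨k, rfl | rfl⟩ := m.eq_nat_or_neg
  · rcases k with _ | k
    · have : (1 + 1 : RatFunc ℚ) ≠ 0 := by norm_num
      simp [negPoch, qPochZ, qPoch, q_ne_zero, this]
    · have h : ((k + 1 : ℕ) : ℤ) - 1 = k := by push_cast; ring
      rw [h]
      simp only [negPoch, qPochZ, qPoch, Int.natCast_nonneg, if_true, Int.toNat_natCast,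
        prod_range_succ, zpow_natCast, pow_succ]
      ring
  · have h2 : ¬ (0 : ℤ) ≤ -(k : ℤ) - 1 := by omega
    have h3 : (-(-(k : ℤ) - 1)).toNat = k + 1 := by omega
    have key : qPoch (-q * q ^ (-(k : ℤ) - 1)) (k + 1) =
        (1 + q ^ (-(k : ℤ))) * qPoch (-q * q ^ (-(k : ℤ))) k := by
      simp only [qPoch]
      rw [prod_range_succ', mul_comm]
      congr 1
      · rw [zpow_sub₀ q_ne_zero, zpow_one]
        field_simp [q_ne_zero]
        ring
      · refine prod_congr rfl fun j _ => ?_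
        rw [zpow_sub₀ q_ne_zero, zpow_one, pow_succ]
        field_simp [q_ne_zero]
    have h0 := one_add_q_zpow_ne_zero (-(k : ℤ))
    have e1 : negPoch (-(k : ℤ) - 1) =
        1 / ((1 + q ^ (-(k : ℤ))) * qPoch (-q * q ^ (-(k : ℤ))) k) := by
      rw [negPoch, qPochZ, if_neg h2, h3, key]
    have e2 : negPoch (-(k : ℤ)) = 1 / qPoch (-q * q ^ (-(k : ℤ))) k := by
      rcases k with _ | k
      · simp [negPoch, qPochZ, qPoch]
      · rw [negPoch, qPochZ, if_neg (by omega)]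
        simp
    rw [e1, e2, one_div, one_div, mul_inv]
    field_simp

lemma negPoch_ne_zero (m : ℤ) : negPoch m ≠ 0 := by
  induction m using Int.induction_on with
  | zero => simp [negPoch_zero]
  | succ k ih =>
    rw [negPoch_succ, add_sub_cancel_right]
    exact mul_ne_zero ih (one_add_q_zpow_ne_zero _)
  | pred k ih =>
    rw [negPoch_succ] at ih
    exact left_ne_zero_of_mul ih

/-- Reflection formula for `(-q; q)_n`. -/
lemma negPoch_mul_reflect (n : ℕ) :
    2 * (negPoch n * negPoch (-n - 1)) = q ^ ((n : ℤ) * (n + 1) / 2) := by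
  induction n with
  | zero =>
    have h := negPoch_succ 0
    rw [negPoch_zero] at h
    simp only [zpow_zero, zero_sub] at h
    simp [negPoch_zero]
    linear_combination -h
  | succ n ih =>
    have h1 := negPoch_succ ((n + 1 : ℕ) : ℤ)
    have h2 := negPoch_succ (-(n : ℤ) - 1)
    have e1 : ((n + 1 : ℕ) : ℤ) - 1 = n := by push_cast; ring
    have e2 : -((n + 1 : ℕ) : ℤ) - 1 = -(n : ℤ) - 1 - 1 := by push_cast; ring
    have e3 : ((n + 1 : ℕ) : ℤ) * (((n + 1 : ℕ) : ℤ) + 1) / 2 =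
        (n : ℤ) * (n + 1) / 2 + (n + 1) := by
      rw [← Int.add_mul_ediv_right _ _ (by norm_num)]
      congr 1; push_cast; ring
    rw [e1] at h1
    rw [e2, e3, zpow_add₀ q_ne_zero, ← ih, h1, h2]
    have e4 : -(n : ℤ) - 1 = -((n : ℤ) + 1) := by ring
    rw [show ((n + 1 : ℕ) : ℤ) = (n : ℤ) + 1 by push_cast; ring, e4, zpow_neg]
    have := zpow_ne_zero ((n : ℤ) + 1) q_ne_zero
    field_simp
    ring

/-- The `q`-factorial `(q; q)_m`, set to `0` for negative `m`. -/
noncomputable def qfac (m : ℤ) : RatFunc ℚ := if 0 ≤ m then qPoch q m.toNat else 0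

lemma qPoch_ne_zero (k : ℕ) : qPoch q k ≠ 0 := by
  refine prod_ne_zero_iff.2 fun j _ => ?_
  rw [← pow_succ']
  exact sub_ne_zero.2 (q_pow_ne_one (by omega)).symm

lemma qfac_ne_zero {m : ℤ} (hm : 0 ≤ m) : qfac m ≠ 0 := by
  rw [qfac, if_pos hm]; exact qPoch_ne_zero _

lemma qfac_zero : qfac 0 = 1 := by simp [qfac, qPoch]

lemma qfac_succ {m : ℤ} (hm : 0 < m) : qfac m = (1 - q ^ m) * qfac (m - 1) := by
  obtain ⟨k, rfl⟩ : ∃ k : ℕ, m = k + 1 := ⟨(m - 1).toNat, by omega⟩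
  rw [qfac, qfac, if_pos (by omega), if_pos (by omega), add_sub_cancel_right,
    Int.toNat_natCast, show ((k : ℤ) + 1).toNat = k + 1 by omega, qPoch, prod_range_succ, qPoch,
    zpow_add₀ q_ne_zero, zpow_natCast, zpow_one]
  ring

lemma inv_qfac_of_neg {m : ℤ} (hm : m < 0) : (qfac m)⁻¹ = 0 := by
  rw [qfac, if_neg (by omega), inv_zero]

/-- With `1 / (q; q)_m = 0` for `m < 0`, the factorial recurrence holds for every integer. -/
lemma inv_qfac_pred (m : ℤ) : (qfac (m - 1))⁻¹ = (1 - q ^ m) * (qfac m)⁻¹ := by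
  rcases lt_trichotomy m 0 with h | rfl | h
  · rw [inv_qfac_of_neg h, inv_qfac_of_neg (by omega), mul_zero]
  · rw [inv_qfac_of_neg (by omega)]; simp
  · rw [qfac_succ h, mul_inv, mul_inv_cancel_left₀ (one_sub_q_zpow_ne_zero h.ne')]

lemma qbinom_eq {N s : ℤ} (hN : 0 ≤ N) :
    qbinom N s = qfac N * ((qfac s)⁻¹ * (qfac (N - s))⁻¹) := by
  rw [qbinom]
  split_ifs with h
  · rw [qfac, qfac, qfac, if_pos hN, if_pos h.1, if_pos (by omega), div_eq_mul_inv, mul_inv]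
  · rcases lt_or_ge s 0 with h' | h'
    · rw [inv_qfac_of_neg h']; ring
    · rw [inv_qfac_of_neg (m := N - s) (by omega)]; ring

lemma one_sub_mul_qbinom_pred {N s : ℤ} (hN : 0 ≤ N) :
    (1 - q ^ N) * qbinom (N - 1) s = qfac N * ((qfac s)⁻¹ * (qfac (N - 1 - s))⁻¹) := by
  rcases hN.eq_or_lt with rfl | hN
  · rcases lt_or_ge s 0 with h | h
    · rw [inv_qfac_of_neg h]; simp
    · rw [inv_qfac_of_neg (m := 0 - 1 - s) (by omega)]; simp
  · rw [qbinom_eq (by omega), qfac_succ hN]; ring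

lemma qbinom_of_lt {N s : ℤ} (h : N < s) : qbinom N s = 0 := by
  rw [qbinom, if_neg (by omega)]

lemma qbinom_of_neg {N s : ℤ} (h : s < 0) : qbinom N s = 0 := by
  rw [qbinom, if_neg (by omega)]

lemma qbinom_zero_right {N : ℤ} (hN : 0 ≤ N) : qbinom N 0 = 1 := by
  rw [qbinom_eq hN, qfac_zero, sub_zero, inv_one, one_mul, mul_inv_cancel₀ (qfac_ne_zero hN)]

lemma qbinom_self {N : ℤ} (hN : 0 ≤ N) : qbinom N N = 1 := by
  rw [qbinom_eq hN, sub_self, qfac_zero, inv_one, mul_one, mul_inv_cancel₀ (qfac_ne_zero hN)]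

/-- The `q`-Pascal rule. -/
lemma qbinom_succ {N : ℤ} (hN : 0 ≤ N) (s : ℤ) :
    qbinom (N + 1) s = qbinom N s + q ^ (N + 1 - s) * qbinom N (s - 1) := by
  have h1 := inv_qfac_pred s
  have h2 := inv_qfac_pred (N + 1 - s)
  rw [qbinom_eq hN, qbinom_eq hN, qbinom_eq (by omega : 0 ≤ N + 1),
    qfac_succ (by omega : 0 < N + 1), add_sub_cancel_right, h1,
    show N - s = N + 1 - s - 1 by ring, h2, show N - (s - 1) = N + 1 - s by ring]
  have e : q ^ (N + 1) = q ^ s * q ^ (N + 1 - s) := by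
    rw [← zpow_add₀ q_ne_zero]; congr 1; ring
  rw [e]
  ring

/-- The signed Gaussian weight `(-1)^s q^(s(s-1)/2)` at an integer `s`. -/
noncomputable def altWeight (s : ℤ) : RatFunc ℚ := (-1) ^ s * q ^ (s * (s - 1) / 2)

lemma altWeight_zero : altWeight 0 = 1 := by simp [altWeight]

lemma altWeight_ne_zero (s : ℤ) : altWeight s ≠ 0 :=
  mul_ne_zero (zpow_ne_zero _ (by norm_num)) (zpow_ne_zero _ q_ne_zero)

lemma altWeight_succ (s : ℤ) : altWeight (s + 1) = -q ^ s * altWeight s := by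
  have e : (s + 1) * (s + 1 - 1) / 2 = s * (s - 1) / 2 + s := by
    rw [← Int.add_mul_ediv_right _ _ (by norm_num)]
    congr 1; ring
  rw [altWeight, altWeight, e, zpow_add₀ q_ne_zero, zpow_add₀ (by norm_num), zpow_one]
  ring

/-- The sum of `[M choose s]_q (-1)^s q^(s(s-1)/2) φ(s)` over `0 ≤ s ≤ M`. -/
noncomputable def altSum (M : ℕ) (φ : ℤ → RatFunc ℚ) : RatFunc ℚ :=
  ∑ s ∈ range (M + 1), qbinom M s * altWeight s * φ s

lemma altSum_zero (φ : ℤ → RatFunc ℚ) : altSum 0 φ = φ 0 := by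
  simp [altSum, altWeight_zero, qbinom_zero_right]

lemma altSum_eq_of_lt {M L : ℕ} (h : M < L) (φ : ℤ → RatFunc ℚ) :
    ∑ s ∈ range L, qbinom M s * altWeight s * φ s = altSum M φ := by
  refine (sum_subset (range_subset_range.2 h) fun s _ hs => ?_).symm
  rw [mem_range] at hs
  rw [qbinom_of_lt (by omega)]
  ring

lemma altSum_succ (M : ℕ) (φ : ℤ → RatFunc ℚ) :
    altSum (M + 1) φ = altSum M φ - q ^ M * altSum M (fun s => φ (s + 1)) := by
  have h1 : ∀ s ∈ range (M + 1 + 1), qbinom ((M + 1 : ℕ) : ℤ) s * altWeight s * φ s =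
      qbinom M s * altWeight s * φ s +
        q ^ ((M : ℤ) + 1 - s) * qbinom M (s - 1) * altWeight s * φ s := by
    intro s _
    rw [Nat.cast_add, Nat.cast_one, qbinom_succ (by omega)]
    ring
  rw [altSum, sum_congr rfl h1, sum_add_distrib, altSum_eq_of_lt (by omega),
    sum_range_succ', sub_eq_add_neg (altSum M φ)]
  congr 1
  rw [qbinom_of_neg (s := ((0 : ℕ) : ℤ) - 1) (by norm_num), altSum, mul_sum, ← sum_neg_distrib,
    mul_zero, zero_mul, zero_mul, add_zero]
  refine sum_congr rfl fun s _ => ?_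
  rw [Nat.cast_add, Nat.cast_one, add_sub_cancel_right, altWeight_succ,
    show (M : ℤ) + 1 - (s + 1) = M - s by ring, zpow_sub₀ q_ne_zero, zpow_natCast]
  have := zpow_ne_zero (s : ℤ) q_ne_zero
  field_simp

lemma altSum_const_mul (M : ℕ) (a : RatFunc ℚ) (φ : ℤ → RatFunc ℚ) :
    altSum M (fun s => a * φ s) = a * altSum M φ := by
  rw [altSum, altSum, mul_sum]
  exact sum_congr rfl fun s _ => by ring

lemma altSum_add (M : ℕ) (φ ψ : ℤ → RatFunc ℚ) :
    altSum M (fun s => φ s + ψ s) = altSum M φ + altSum M ψ := by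
  rw [altSum, altSum, altSum, ← sum_add_distrib]
  exact sum_congr rfl fun s _ => by ring

/-- The `q`-binomial theorem, one factor at a time. -/
lemma altSum_zpow_succ (M : ℕ) {z : RatFunc ℚ} (hz : z ≠ 0) :
    altSum (M + 1) (fun s => z ^ s) = (1 - q ^ M * z) * altSum M (fun s => z ^ s) := by
  have h : (fun s : ℤ => z ^ (s + 1)) = fun s => z * z ^ s := by
    ext1 s; rw [zpow_add₀ hz, zpow_one, mul_comm]
  rw [altSum_succ, h, altSum_const_mul]
  ring

lemma altSum_one (M : ℕ) : altSum (M + 1) (fun _ => 1) = 0 := by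
  have h : ∀ M : ℕ, altSum (M + 1) (fun s => (1 : RatFunc ℚ) ^ s) = 0 := by
    intro M
    induction M with
    | zero => rw [altSum_zpow_succ _ one_ne_zero]; simp
    | succ M ih => rw [altSum_zpow_succ _ one_ne_zero, ih, mul_zero]
  simpa using h M

lemma altSum_inv_zpow (M : ℕ) : altSum (M + 2) (fun s => q⁻¹ ^ s) = 0 := by
  have hq := inv_ne_zero q_ne_zero
  induction M with
  | zero =>
    rw [altSum_zpow_succ _ hq, pow_one, mul_inv_cancel₀ q_ne_zero, sub_self, zero_mul]
  | succ M ih => rw [altSum_zpow_succ _ hq, ih, mul_zero]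

/-- A terminating `₁φ₁` summation. -/
lemma altSum_negPoch (M : ℕ) (n : ℤ) :
    altSum M (fun s => negPoch (n - s)) * negPoch (M - n - 1) =
      negPoch n * negPoch (-n - 1) := by
  induction M generalizing n with
  | zero => rw [altSum_zero]; simp
  | succ M ih =>
    have h1 := ih n
    have h2 := ih (n - 1)
    have h3 := negPoch_succ (M - n)
    have h4 := negPoch_succ n
    have h5 := negPoch_succ (-n)
    have e1 : (fun s : ℤ => negPoch (n - (s + 1))) = fun s => negPoch (n - 1 - s) := by
      ext1 s; congr 1; ring
    rw [show (M : ℤ) - (n - 1) - 1 = M - n by ring, show -(n - 1) - 1 = -n by ring] at h2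
    rw [altSum_succ, e1, show ((M + 1 : ℕ) : ℤ) - n - 1 = M - n by push_cast; ring]
    rw [sub_mul, mul_assoc, h2, h3, ← mul_assoc, h1, h5, h4, zpow_sub₀ q_ne_zero, zpow_neg,
      zpow_natCast]
    have := zpow_ne_zero n q_ne_zero
    field_simp
    ring

/-- The diagonal weight `(-1)^r q^(r(r-1)/2) (-q; q)_{n-r}`. -/
noncomputable def rowWeight (n : ℕ) (r : ℤ) : RatFunc ℚ := altWeight r * negPoch (n - r)

lemma rowWeight_ne_zero (n : ℕ) (r : ℤ) : rowWeight n r ≠ 0 :=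
  mul_ne_zero (altWeight_ne_zero _) (negPoch_ne_zero _)

/-- The matrix whose powers have the multiple sums `W_m(n)` as traces. -/
noncomputable def transfer (n : ℕ) : Matrix (Fin (2 * n + 1)) (Fin (2 * n + 1)) (RatFunc ℚ) :=
  Matrix.of fun r s => rowWeight n (r : ℕ) * qbinom (2 * n - (r : ℕ)) (s : ℕ)

lemma altWeight_natCast (r : ℕ) : altWeight r = (-1) ^ r * q ^ (r * (r - 1) / 2) := by
  have e : (r : ℤ) * (r - 1) / 2 = ((r * (r - 1) / 2 : ℕ) : ℤ) := by
    rcases r with _ | r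
    · simp
    · push_cast; simp
  rw [altWeight, e, zpow_natCast, zpow_natCast]

lemma Wmul_three_eq_trace (n : ℕ) :
    Wmul 3 n = (transfer n * (transfer n * transfer n)).trace := by
  have h : (transfer n * (transfer n * transfer n)).trace =
      ∑ p : Fin (2 * n + 1) × Fin (2 * n + 1) × Fin (2 * n + 1),
        transfer n p.1 p.2.1 * (transfer n p.2.1 p.2.2 * transfer n p.2.2 p.1) := by
    simp only [Matrix.trace, Matrix.diag_apply, Matrix.mul_apply, Fintype.sum_prod_type, mul_sum]
  rw [h, Wmul]
  refine sum_bij' (fun r _ => (Fin.ofNat (2 * n + 1) (r 0), Fin.ofNat (2 * n + 1) (r 1),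
    Fin.ofNat (2 * n + 1) (r 2))) (fun p _ => ![(p.1 : ℕ), (p.2.1 : ℕ), (p.2.2 : ℕ)])
    (fun _ _ => mem_univ _) ?_ ?_ ?_ ?_
  · intro p _
    simp only [Fintype.mem_piFinset, mem_range]
    intro k
    fin_cases k <;> simp <;> omega
  · intro r hr
    simp only [Fintype.mem_piFinset, mem_range] at hr
    ext k
    fin_cases k <;> simp [Nat.mod_eq_of_lt (hr _)]
  · intro p _
    simp
  · intro r hr
    simp only [Fintype.mem_piFinset, mem_range] at hr
    simp only [Fin.prod_univ_three, transfer, rowWeight, altWeight_natCast, negPoch,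
      Matrix.of_apply, Fin.val_ofNat, Nat.mod_eq_of_lt (hr _), zero_add,
      show (1 : Fin 3) + 1 = 2 from rfl, show (2 : Fin 3) + 1 = 0 from rfl]
    ring

noncomputable def triScale (n : ℕ) : RatFunc ℚ := q ^ (3 * (n : ℤ) ^ 2 - 3 * n + 1) / 4

noncomputable def triUp (n : ℕ) (r : ℤ) : RatFunc ℚ :=
  triScale n * (1 + q ^ (n - r)) * (q ^ r * (1 - q ^ (2 * n - r)) * (1 + q ^ (n - r - 1)))

noncomputable def triDiag (n : ℕ) (r : ℤ) : RatFunc ℚ :=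
  triScale n * (1 + q ^ (n - r)) *
    (-q ^ (r - 1) + q ^ (2 * r - 1) + q ^ (2 * r) + q ^ (2 * n - 1 : ℤ) + q ^ (r + n - 1)
      - q ^ (r + 2 * n))

noncomputable def triDown (n : ℕ) (r : ℤ) : RatFunc ℚ :=
  triScale n * (1 + q ^ (n - r)) * (-q ^ (2 * r - 2) * (1 - q ^ r))

/-- The entries of the tridiagonal matrix that turns out to be the fourth power of `transfer n`. -/
noncomputable def triEntry (n : ℕ) (r u : ℤ) : RatFunc ℚ :=
  (if u = r + 1 then triUp n r else 0) + (if u = r then triDiag n r else 0) +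
    (if u = r - 1 then triDown n r else 0)

noncomputable def tri (n : ℕ) : Matrix (Fin (2 * n + 1)) (Fin (2 * n + 1)) (RatFunc ℚ) :=
  Matrix.of fun r u => triEntry n (r : ℕ) (u : ℕ)

lemma triUp_two_mul (n : ℕ) : triUp n (2 * n) = 0 := by simp [triUp]

lemma triDown_zero (n : ℕ) : triDown n 0 = 0 := by simp [triDown]

lemma sum_fin_ite_eq (N : ℕ) (m : ℤ) (f : ℤ → RatFunc ℚ) :
    ∑ u : Fin N, (if ((u : ℕ) : ℤ) = m then f (u : ℕ) else 0) =
      if 0 ≤ m ∧ m < N then f m else 0 := by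
  split_ifs with h
  · lift m to ℕ using h.1
    rw [sum_eq_single (⟨m, by omega⟩ : Fin N)]
    · simp
    · intro u _ hu
      rw [if_neg]
      intro h'
      exact hu (Fin.ext (by exact_mod_cast h'))
    · simp
  · refine sum_eq_zero fun u _ => if_neg ?_
    have := u.2
    omega

lemma sum_triEntry_row (n : ℕ) {r : ℤ} (h0 : 0 ≤ r) (h1 : r ≤ 2 * n) (f : ℤ → RatFunc ℚ) :
    ∑ u : Fin (2 * n + 1), triEntry n r (u : ℕ) * f (u : ℕ) =
      triUp n r * f (r + 1) + triDiag n r * f r + triDown n r * f (r - 1) := by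
  simp only [triEntry, add_mul, sum_add_distrib, ite_mul, zero_mul]
  rw [sum_fin_ite_eq _ _ fun u => triUp n r * f u, sum_fin_ite_eq _ _ fun u => triDiag n r * f u,
    sum_fin_ite_eq _ _ fun u => triDown n r * f u, if_pos (by omega : 0 ≤ r ∧ _)]
  congr 2
  · rcases h1.eq_or_lt with rfl | h
    · rw [triUp_two_mul]; simp
    · rw [if_pos (by omega)]
  · rcases h0.eq_or_lt with rfl | h
    · rw [triDown_zero]; simp
    · rw [if_pos (by omega)]

lemma sum_triEntry_col (n : ℕ) {s : ℤ} (h0 : 0 ≤ s) (h1 : s ≤ 2 * n) {f : ℤ → RatFunc ℚ}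
    (hf0 : f (-1) = 0) (hf1 : f (2 * n + 1) = 0) :
    ∑ u : Fin (2 * n + 1), f (u : ℕ) * triEntry n (u : ℕ) s =
      f (s - 1) * triUp n (s - 1) + f s * triDiag n s + f (s + 1) * triDown n (s + 1) := by
  have e1 : ∀ u : ℤ, s = u + 1 ↔ u = s - 1 := by intro u; omega
  have e2 : ∀ u : ℤ, s = u ↔ u = s := by intro u; omega
  have e3 : ∀ u : ℤ, s = u - 1 ↔ u = s + 1 := by intro u; omega
  simp only [triEntry, mul_add, sum_add_distrib, mul_ite, mul_zero, e1, e3]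
  simp only [e2]
  rw [sum_fin_ite_eq _ _ fun u => f u * triUp n u, sum_fin_ite_eq _ _ fun u => f u * triDiag n u,
    sum_fin_ite_eq _ _ fun u => f u * triDown n u, if_pos (by omega : 0 ≤ s ∧ _)]
  congr 2
  · rcases h0.eq_or_lt with rfl | h
    · simp [hf0]
    · rw [if_pos (by omega)]
  · rcases h1.eq_or_lt with rfl | h
    · simp [hf1]
    · rw [if_pos (by omega)]

lemma rowWeight_eq (n : ℕ) (r : ℤ) :
    rowWeight n r = altWeight r * negPoch (n - r - 1) * (1 + q ^ (n - r)) := by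
  rw [rowWeight, negPoch_succ (n - r)]; ring

lemma rowWeight_succ (n : ℕ) (r : ℤ) :
    rowWeight n (r + 1) = -q ^ r * (altWeight r * negPoch (n - r - 1)) := by
  rw [rowWeight, altWeight_succ, show (n : ℤ) - (r + 1) = n - r - 1 by ring]; ring

lemma rowWeight_pred (n : ℕ) (r : ℤ) :
    rowWeight n (r - 1) = -q ^ (1 - r) * (altWeight r * negPoch (n - r - 1)) *
      ((1 + q ^ (n - r)) * (1 + q ^ (n - r + 1))) := by
  have h1 := altWeight_succ (r - 1)
  have h2 := negPoch_succ (n - r + 1)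
  rw [add_sub_cancel_right] at h2
  rw [sub_add_cancel] at h1
  rw [rowWeight, show (n : ℤ) - (r - 1) = n - r + 1 by ring, h2, negPoch_succ (n - r), h1,
    show 1 - r = -(r - 1) by ring, zpow_neg]
  have := zpow_ne_zero (r - 1) q_ne_zero
  field_simp

/-- The entrywise form of the commutation of `tri n` and `transfer n`. -/
lemma tri_transfer_entry (n : ℕ) {r : ℤ} (hr : r ≤ 2 * n) (s : ℤ) :
    triUp n r * (rowWeight n (r + 1) * qbinom (2 * n - (r + 1)) s) +
        triDiag n r * (rowWeight n r * qbinom (2 * n - r) s) +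
        triDown n r * (rowWeight n (r - 1) * qbinom (2 * n - (r - 1)) s) =
      rowWeight n r * qbinom (2 * n - r) (s - 1) * triUp n (s - 1) +
        rowWeight n r * qbinom (2 * n - r) s * triDiag n s +
        rowWeight n r * qbinom (2 * n - r) (s + 1) * triDown n (s + 1) := by
  have hN : 0 ≤ 2 * (n : ℤ) - r := by omega
  have hup : triUp n r * (rowWeight n (r + 1) * qbinom (2 * n - (r + 1)) s) =
      triScale n * (1 + q ^ (n - r)) * (q ^ r * (1 + q ^ (n - r - 1))) * rowWeight n (r + 1) *
        (qfac (2 * n - r) * ((qfac s)⁻¹ * (qfac (2 * n - r - 1 - s))⁻¹)) := by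
    rw [← one_sub_mul_qbinom_pred hN, triUp, show 2 * (n : ℤ) - (r + 1) = 2 * n - r - 1 by ring]
    ring
  rw [hup, qbinom_eq hN, qbinom_eq hN, qbinom_eq hN,
    qbinom_eq (by omega : 0 ≤ 2 * (n : ℤ) - (r - 1)),
    show 2 * (n : ℤ) - (r - 1) = 2 * n - r + 1 by ring,
    qfac_succ (by omega : 0 < 2 * (n : ℤ) - r + 1), add_sub_cancel_right]
  have a1 := inv_qfac_pred (s + 1)
  have a2 := inv_qfac_pred s
  have b1 := inv_qfac_pred (2 * n - r + 1 - s)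
  have b2 := inv_qfac_pred (2 * n - r - s)
  rw [add_sub_cancel_right] at a1
  rw [show 2 * (n : ℤ) - r + 1 - s - 1 = 2 * n - r - s by ring] at b1
  rw [show 2 * (n : ℤ) - r - s - 1 = 2 * n - r - 1 - s by ring] at b2
  rw [show 2 * (n : ℤ) - r - (s - 1) = 2 * n - r + 1 - s by ring,
    show 2 * (n : ℤ) - r - (s + 1) = 2 * n - r - 1 - s by ring, a2, a1, b2, b1,
    rowWeight_succ, rowWeight_pred, rowWeight_eq]
  generalize (qfac (s + 1))⁻¹ = β
  generalize (qfac (2 * n - r + 1 - s))⁻¹ = γ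
  generalize qfac (2 * n - r) = N
  generalize altWeight r * negPoch (n - r - 1) = δ
  simp only [triDiag, triDown, triUp]
  generalize triScale n = c
  have hq := q_ne_zero
  have hx := zpow_ne_zero (n : ℤ) q_ne_zero
  have hX := zpow_ne_zero r q_ne_zero
  have hY := zpow_ne_zero s q_ne_zero
  simp only [zpow_add₀ q_ne_zero, zpow_sub₀ q_ne_zero, q_zpow_two_mul, zpow_ofNat]
  generalize q ^ (n : ℤ) = x at *
  generalize q ^ r = X at *
  generalize q ^ s = Y at *
  field_simp
  ring

lemma tri_mul_transfer (n : ℕ) : tri n * transfer n = transfer n * tri n := by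
  ext r s
  have hr := r.2
  have hs := s.2
  simp only [Matrix.mul_apply, tri, transfer, Matrix.of_apply]
  rw [sum_triEntry_row n (by omega) (by omega)
      fun u => rowWeight n u * qbinom (2 * n - u) (s : ℕ),
    sum_triEntry_col n (f := fun u => rowWeight n (r : ℕ) * qbinom (2 * n - (r : ℕ)) u)
      (by omega) (by omega) (by simp [qbinom_of_neg])
      (by rw [qbinom_of_lt (by omega), mul_zero])]
  exact tri_transfer_entry n (by omega) _

/-- The pairing of a row of `transfer n` with a vector that carries the weight `altWeight`. -/
lemma sum_transfer_mul (n : ℕ) (r : Fin (2 * n + 1)) (φ : ℤ → RatFunc ℚ) :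
    ∑ s : Fin (2 * n + 1), transfer n r s * (altWeight (s : ℕ) * φ (s : ℕ)) =
      rowWeight n (r : ℕ) * altSum (2 * n - r) φ := by
  have hr := r.2
  have e : ((2 * n - r : ℕ) : ℤ) = 2 * n - (r : ℕ) := by omega
  rw [← altSum_eq_of_lt (L := 2 * n + 1) (by omega), mul_sum,
    ← Fin.sum_univ_eq_sum_range (fun s : ℕ => rowWeight n (r : ℕ) *
      (qbinom ((2 * n - r : ℕ) : ℤ) s * altWeight s * φ s))]
  refine sum_congr rfl fun s _ => ?_
  rw [e, transfer, Matrix.of_apply]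
  ring

lemma transfer_sq_col_zero (n : ℕ) (r : Fin (2 * n + 1)) :
    (transfer n * transfer n) r 0 =
      negPoch n * negPoch (-n - 1) * (altWeight (r : ℕ) * (1 + q ^ ((n : ℤ) - (r : ℕ)))) := by
  have hr := r.2
  have h := sum_transfer_mul n r fun s => negPoch (n - s)
  have e : ((2 * n - r : ℕ) : ℤ) - n - 1 = n - (r : ℕ) - 1 := by omega
  have h' := altSum_negPoch (2 * n - r) n
  rw [e] at h'
  rw [← h', mul_comm (altSum _ _), mul_assoc, Matrix.mul_apply]
  refine Eq.trans (sum_congr rfl fun s _ => ?_) (h.trans ?_)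
  · have hs := s.2
    congr 1
    rw [transfer, Matrix.of_apply, rowWeight, Fin.val_zero, Nat.cast_zero,
      qbinom_zero_right (by omega), mul_one]
  · rw [rowWeight_eq]; ring

lemma transfer_cube_col_zero (n : ℕ) (r : Fin (2 * n + 1)) :
    (transfer n * (transfer n * transfer n)) r 0 =
      negPoch n * negPoch (-n - 1) *
        (rowWeight n (r : ℕ) * altSum (2 * n - r) fun s => 1 + q ^ (n : ℤ) * q⁻¹ ^ s) := by
  rw [← sum_transfer_mul, Matrix.mul_apply, mul_sum]
  refine sum_congr rfl fun s _ => ?_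
  rw [transfer_sq_col_zero, zpow_sub₀ q_ne_zero, inv_zpow, div_eq_mul_inv]
  ring

lemma altSum_one_add_inv_zpow (M : ℕ) (a : RatFunc ℚ) :
    altSum M (fun s => 1 + a * q⁻¹ ^ s) =
      if M = 0 then 1 + a else if M = 1 then a * (1 - q⁻¹) else 0 := by
  rw [altSum_add M (fun _ => 1), altSum_const_mul]
  match M with
  | 0 => simp [altSum_zero]
  | 1 =>
    rw [altSum_one, altSum_zpow_succ _ (inv_ne_zero q_ne_zero), altSum_zero]
    simp
  | M + 2 =>
    rw [altSum_one, altSum_inv_zpow]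
    simp

lemma negPoch_sq_mul_altWeight (n : ℕ) :
    4 * (negPoch n * negPoch (-n - 1)) ^ 2 * altWeight (2 * n) = q ^ (3 * (n : ℤ) ^ 2) := by
  have h := negPoch_mul_reflect n
  have e : (2 * (n : ℤ)) * (2 * n - 1) / 2 = n * (2 * n - 1) := by
    rw [mul_assoc]; exact Int.mul_ediv_cancel_left _ (by norm_num)
  obtain ⟨a, ha⟩ : ∃ a : ℤ, (n : ℤ) * (n + 1) = 2 * a := (Int.even_mul_succ_self n).two_dvd
  rw [ha, Int.mul_ediv_cancel_left _ (by norm_num)] at h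
  have e2 : 3 * (n : ℤ) ^ 2 = a + a + n * (2 * n - 1) := by linarith
  rw [altWeight, e, zpow_mul (-1 : RatFunc ℚ), e2, zpow_add₀ q_ne_zero, zpow_add₀ q_ne_zero, ← h,
    show (-1 : RatFunc ℚ) ^ (2 : ℤ) = 1 by norm_num, one_zpow]
  ring

lemma triScale_eq (n : ℕ) : triScale n = q ^ (3 * (n : ℤ) ^ 2) * q / (4 * (q ^ (n : ℤ)) ^ 3) := by
  rw [triScale, zpow_add₀ q_ne_zero, zpow_sub₀ q_ne_zero, mul_comm 3 (n : ℤ),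
    zpow_mul q (n : ℤ), zpow_one, zpow_ofNat]
  have := zpow_ne_zero (n : ℤ) q_ne_zero
  field_simp

lemma transfer_fourth_col_zero {n : ℕ} (hn : 1 ≤ n) (r : Fin (2 * n + 1)) :
    (transfer n * (transfer n * (transfer n * transfer n))) r 0 = tri n r 0 := by
  have hr := r.2
  have hsum : (transfer n * (transfer n * (transfer n * transfer n))) r 0 =
      rowWeight n (r : ℕ) * (negPoch n * negPoch (-n - 1)) *
        (qbinom (2 * n - (r : ℕ)) (2 * n - 1) *
            (rowWeight n (2 * n - 1) * (q ^ (n : ℤ) * (1 - q⁻¹))) +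
          qbinom (2 * n - (r : ℕ)) (2 * n) * (rowWeight n (2 * n) * (1 + q ^ (n : ℤ)))) := by
    rw [Matrix.mul_apply]
    simp only [transfer_cube_col_zero, altSum_one_add_inv_zpow]
    simp only [transfer, Matrix.of_apply]
    rw [Fin.sum_univ_eq_sum_range (fun s : ℕ => rowWeight n (r : ℕ) *
      qbinom (2 * n - (r : ℕ)) s * (negPoch n * negPoch (-n - 1) * (rowWeight n s *
        (if 2 * n - s = 0 then 1 + q ^ (n : ℤ) else
          if 2 * n - s = 1 then q ^ (n : ℤ) * (1 - q⁻¹) else 0)))) (2 * n + 1)]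
    obtain ⟨m, hm⟩ : ∃ m, 2 * n = m + 1 := ⟨2 * n - 1, by omega⟩
    have em : (m : ℤ) = 2 * n - 1 := by omega
    generalize ((r : ℕ) : ℤ) = ρ
    rw [hm, sum_range_succ, sum_range_succ, sum_eq_zero, if_neg (by omega), if_pos (by omega),
      if_pos (by omega), Nat.cast_add, Nat.cast_one, em, sub_add_cancel]
    · ring
    · intro s hs
      rw [mem_range] at hs
      rw [if_neg (by omega), if_neg (by omega)]
      ring
  have hscale := negPoch_sq_mul_altWeight n
  have hpred := rowWeight_pred n (2 * n)
  have heq := rowWeight_eq n (2 * n)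
  have hd0 : rowWeight n 0 = negPoch n := by simp [rowWeight, altWeight_zero]
  rw [show (n : ℤ) - 2 * n - 1 = -n - 1 by ring, show (n : ℤ) - 2 * n = -n by ring] at hpred heq
  rw [hsum, tri, Matrix.of_apply, hpred, heq, Fin.val_zero, Nat.cast_zero]
  have hx := zpow_ne_zero (n : ℤ) q_ne_zero
  have hq := q_ne_zero
  rcases Nat.lt_or_ge 1 r with h2 | h2
  · rw [qbinom_of_lt (by omega), qbinom_of_lt (by omega), triEntry, if_neg (by omega),
      if_neg (by omega), if_neg (by omega)]
    ring
  rcases h2.eq_or_lt with h1 | h1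
  · have hd1 := rowWeight_succ n 0
    have hd1' := rowWeight_eq n 0
    have hx1 := one_add_q_zpow_ne_zero n
    rw [hd0, sub_zero] at hd1'
    rw [zero_add, sub_zero, zpow_zero] at hd1
    rw [h1, Nat.cast_one, qbinom_self (by omega), qbinom_of_lt (by omega), triEntry,
      if_neg (by omega), if_neg (by omega), if_pos (by omega), triDown, triScale_eq, ← hscale,
      hd1, hd1']
    simp only [zpow_add₀ q_ne_zero, zpow_sub₀ q_ne_zero, q_zpow_two_mul, zpow_neg, zpow_one,
      mul_one, zpow_zero, sub_self]
    generalize q ^ (n : ℤ) = x at *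
    field_simp
    ring
  · have h0 : (r : ℕ) = 0 := by omega
    have hb : qbinom (2 * n) (2 * n - 1) = (1 - q ^ (2 * (n : ℤ))) / (1 - q) := by
      have hf : qfac (2 * n - 1) ≠ 0 := qfac_ne_zero (by omega)
      have h1f := qfac_succ (m := 1) one_pos
      rw [sub_self, qfac_zero, mul_one, zpow_one] at h1f
      rw [qbinom_eq (by omega), sub_sub_cancel, h1f, qfac_succ (m := 2 * n) (by omega)]
      field_simp
    have hq1 : 1 - q ≠ 0 := by simpa using one_sub_q_zpow_ne_zero (m := 1) one_ne_zero
    rw [h0, Nat.cast_zero, sub_zero, hb, qbinom_self (by omega), triEntry, if_neg (by omega),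
      if_pos rfl, if_neg (by omega), triDiag, triScale_eq, ← hscale, hd0]
    simp only [zpow_add₀ q_ne_zero, zpow_sub₀ q_ne_zero, q_zpow_two_mul, zpow_neg, zpow_one,
      zpow_zero, mul_zero, sub_zero]
    generalize q ^ (n : ℤ) = x at *
    field_simp
    ring

lemma triDown_ne_zero (n : ℕ) {r : ℤ} (hr : r ≠ 0) : triDown n r ≠ 0 := by
  have h1 := zpow_ne_zero (3 * (n : ℤ) ^ 2 - 3 * n + 1) q_ne_zero
  have h2 := zpow_ne_zero (2 * r - 2) q_ne_zero
  have h3 := one_sub_q_zpow_ne_zero hr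
  have h4 := one_add_q_zpow_ne_zero (n - r)
  simp [triDown, triScale, h1, h2, h3, h4]

/-- A matrix commuting with `tri n` is determined by its first column. -/
lemma eq_zero_of_commute_tri {n : ℕ} {X : Matrix (Fin (2 * n + 1)) (Fin (2 * n + 1)) (RatFunc ℚ)}
    (hX : tri n * X = X * tri n) (h0 : ∀ r, X r 0 = 0) : X = 0 := by
  have key : ∀ m : ℕ, ∀ (s : Fin (2 * n + 1)), (s : ℕ) ≤ m → ∀ r, X r s = 0 := by
    intro m
    induction m with
    | zero =>
      intro s hs r
      rw [show s = 0 from Fin.ext (by simpa using hs)]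
      exact h0 r
    | succ m ih =>
      intro s hs r
      rcases hs.lt_or_eq with h | h
      · exact ih s (by omega) r
      have hs2 := s.2
      let t : Fin (2 * n + 1) := ⟨m, by omega⟩
      have hc := congrFun (congrFun hX r) t
      rw [Matrix.mul_apply, Matrix.mul_apply, sum_eq_zero fun u _ => by rw [ih t le_rfl, mul_zero],
        sum_eq_single s] at hc
      · have hd : tri n s t = triDown n (s : ℕ) := by
          have ht : ((t : ℕ) : ℤ) = (s : ℕ) - 1 := by simp [t, h]
          rw [tri, Matrix.of_apply, triEntry, ht, if_neg (by omega), if_neg (by omega), if_pos rfl]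
          ring
        rw [hd] at hc
        exact (mul_eq_zero.1 hc.symm).resolve_right (triDown_ne_zero n (by omega))
      · intro u _ hu
        rcases Nat.lt_or_ge u s with h' | h'
        · rw [ih u (by omega), zero_mul]
        · have hne : (u : ℕ) ≠ s := fun h => hu (Fin.ext h)
          have ht : ((t : ℕ) : ℤ) = m := rfl
          rw [tri, Matrix.of_apply, triEntry, ht, if_neg (by omega), if_neg (by omega),
            if_neg (by omega)]
          ring
      · simp
  ext r s
  exact key s s le_rfl r

lemma transfer_fourth {n : ℕ} (hn : 1 ≤ n) :
    transfer n * (transfer n * (transfer n * transfer n)) = tri n := by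
  rw [← sub_eq_zero]
  refine eq_zero_of_commute_tri (n := n) ?_ fun r => ?_
  · have h : Commute (tri n) (transfer n) := tri_mul_transfer n
    exact ((h.mul_right (h.mul_right (h.mul_right h))).sub_right (Commute.refl _)).eq
  · rw [Matrix.sub_apply, transfer_fourth_col_zero hn, sub_self]

/-- The entries of the inverse of `transfer n`. -/
noncomputable def invEntry (n : ℕ) (r u : ℤ) : RatFunc ℚ :=
  altWeight (r + u - 2 * n) * qbinom r (2 * n - u) / rowWeight n u

lemma qbinom_mul_qbinom {r i s : ℤ} (hi : i ≤ r) (hs : s ≤ r) (hr : 0 ≤ r) :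
    qbinom r (r - i) * qbinom (r - i) s = qbinom r s * qbinom (r - s) i := by
  rw [qbinom_eq hr, qbinom_eq (by omega : 0 ≤ r - i), qbinom_eq hr,
    qbinom_eq (by omega : 0 ≤ r - s), sub_sub_cancel, sub_right_comm r s i]
  have h1 := mul_inv_cancel₀ (qfac_ne_zero (by omega : 0 ≤ r - i))
  have h2 := mul_inv_cancel₀ (qfac_ne_zero (by omega : 0 ≤ r - s))
  linear_combination (qfac r * (qfac i)⁻¹ * (qfac s)⁻¹ * (qfac (r - i - s))⁻¹) * (h1 - h2)

lemma sum_range_eq_of_eq_zero {f : ℕ → RatFunc ℚ} (m L : ℕ) (hf : ∀ u < m, f u = 0) :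
    ∑ u ∈ range (m + L), f u = ∑ i ∈ range L, f (m + i) := by
  rw [sum_range_add, sum_eq_zero fun u hu => hf u (mem_range.1 hu), zero_add]

lemma sum_altWeight_mul_qbinom {n r : ℕ} (hr : r ≤ 2 * n) (s : ℕ) :
    ∑ u ∈ range (2 * n + 1), altWeight ((r : ℤ) + u - 2 * n) * qbinom r (2 * n - u) *
      qbinom (2 * n - u) s = if r = s then 1 else 0 := by
  obtain ⟨m, hm⟩ := Nat.exists_eq_add_of_le hr
  have hm' : 2 * (n : ℤ) = r + m := by exact_mod_cast hm
  rw [hm, add_comm r m, add_assoc, hm', sum_range_eq_of_eq_zero m]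
  swap
  · intro u hu
    rw [qbinom_of_lt (by omega : (r : ℤ) < r + m - u)]
    simp
  rcases lt_or_ge r s with h | h
  · rw [if_neg (by omega)]
    refine sum_eq_zero fun i _ => ?_
    rw [qbinom_of_lt (by push_cast; omega : (r : ℤ) + m - (m + i : ℕ) < s), mul_zero]
  · have e : ((r - s : ℕ) : ℤ) = r - s := by omega
    have h1 := altSum_eq_of_lt (by omega : r - s < r + 1) fun _ => 1
    rw [e] at h1
    calc _ = qbinom r s * ∑ i ∈ range (r + 1), qbinom ((r : ℤ) - s) i * altWeight i * 1 := by
          rw [mul_sum]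
          refine sum_congr rfl fun i hi => ?_
          rw [mem_range] at hi
          have := qbinom_mul_qbinom (by omega : (i : ℤ) ≤ r) (by omega : (s : ℤ) ≤ r) (by omega)
          rw [show (r : ℤ) + (m + i : ℕ) - (r + m) = i by push_cast; ring,
            show (r : ℤ) + m - (m + i : ℕ) = r - i by push_cast; ring]
          linear_combination altWeight i * this
      _ = _ := by
          rw [h1]
          split_ifs with hrs
          · subst hrs
            rw [Nat.sub_self, altSum_zero, qbinom_self (by omega), mul_one]
          · obtain ⟨k, hk⟩ : ∃ k, r - s = k + 1 := ⟨r - s - 1, by omega⟩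
            rw [hk, altSum_one, mul_zero]

lemma invEntry_mul_transfer (n : ℕ) :
    (Matrix.of fun r u : Fin (2 * n + 1) => invEntry n (r : ℕ) (u : ℕ)) * transfer n = 1 := by
  ext r s
  have hr := r.2
  rw [Matrix.mul_apply, Matrix.one_apply]
  calc _ = ∑ u ∈ range (2 * n + 1), altWeight (((r : ℕ) : ℤ) + u - 2 * n) *
        qbinom (r : ℕ) (2 * n - u) * qbinom (2 * n - u) (s : ℕ) := by
        rw [← Fin.sum_univ_eq_sum_range fun u : ℕ => altWeight (((r : ℕ) : ℤ) + u - 2 * n) *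
          qbinom (r : ℕ) (2 * n - u) * qbinom (2 * n - u) (s : ℕ)]
        refine sum_congr rfl fun u _ => ?_
        have := rowWeight_ne_zero n (u : ℕ)
        simp only [Matrix.of_apply, invEntry, transfer]
        field_simp
    _ = _ := by
        rw [sum_altWeight_mul_qbinom (by omega)]
        simp only [Fin.ext_iff]

lemma Wmul_three_eq_sum {n : ℕ} (hn : 1 ≤ n) :
    Wmul 3 n = ∑ u ∈ range (2 * n + 1), (triUp n u * invEntry n (u + 1) u +
      triDiag n u * invEntry n u u + triDown n u * invEntry n (u - 1) u) := by
  have h : transfer n * (transfer n * transfer n) =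
      (Matrix.of fun r u : Fin (2 * n + 1) => invEntry n (r : ℕ) (u : ℕ)) * tri n := by
    rw [← transfer_fourth hn, ← Matrix.mul_assoc (Matrix.of _), invEntry_mul_transfer,
      Matrix.one_mul]
  rw [Wmul_three_eq_trace, h, Matrix.trace_mul_comm, Matrix.trace,
    ← Fin.sum_univ_eq_sum_range fun u : ℕ => triUp n u * invEntry n (u + 1) u +
      triDiag n u * invEntry n u u + triDown n u * invEntry n (u - 1) u]
  refine sum_congr rfl fun u _ => ?_
  have hu := u.2
  rw [Matrix.diag_apply, Matrix.mul_apply, ← sum_triEntry_row n (by omega) (by omega) fun r =>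
    invEntry n r (u : ℕ)]
  rfl

/-- The polynomial factor of the summand of `W_3(n)`, where `x = q^n` and `y = q^k`. -/
noncomputable def traceFactor (x y : RatFunc ℚ) : RatFunc ℚ :=
  (1 - q * y ^ 2) * (2 * x ^ 2 - x * y + x ^ 2 * y + q * x ^ 2 * y ^ 2 - q * x ^ 3 * y) -
    x * y * (y - x) * (1 + q * y) * (1 - q * x * y)

/-- The coefficients of the recurrence for `W_3(n)`, where `x = q^n`. -/
noncomputable def recCoeff (x : RatFunc ℚ) : ℕ → RatFunc ℚ
  | 0 => -(x ^ 15 * q ^ 24) * (1 + x * q ^ 2) * (-1 + x * q ^ 3) * (1 + x * q ^ 3) *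
      (1 + x * q ^ 4) * (-1 - 2 * (x * q ^ 2) + x * q ^ 3)
  | 1 => -(x ^ 11 * q ^ 23) * (1 + x * q ^ 3) * (1 + x * q ^ 4) *
      (-1 + q - 2 * (x * q ^ 2) - 2 * (x * q ^ 3) + 2 * (x * q ^ 4)
        - 6 * (x ^ 2 * q ^ 4) + 6 * (x ^ 2 * q ^ 5) - x ^ 2 * q ^ 6 - x ^ 2 * q ^ 7
        + 2 * (x ^ 3 * q ^ 7) + 3 * (x ^ 3 * q ^ 8) - 2 * (x ^ 3 * q ^ 9) - x ^ 3 * q ^ 10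
        + 5 * (x ^ 4 * q ^ 9) - 2 * (x ^ 4 * q ^ 10) - 3 * (x ^ 4 * q ^ 11)
        + 2 * (x ^ 4 * q ^ 12) - 2 * (x ^ 5 * q ^ 12) + 2 * (x ^ 5 * q ^ 13))
  | 2 => x ^ 6 * q ^ 18 * (1 + x * q) * (1 + x * q ^ 4) * (-1 + x ^ 2 * q ^ 5) *
      (1 + 2 * (x * q) - x * q ^ 3 + 7 * (x ^ 2 * q ^ 3) - 6 * (x ^ 2 * q ^ 4)
        - 2 * (x ^ 2 * q ^ 5) + x ^ 2 * q ^ 6 + 2 * (x ^ 3 * q ^ 6) - x ^ 3 * q ^ 8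
        + x ^ 4 * q ^ 10)
  | 3 => x ^ 2 * q ^ 8 * (1 + x * q) * (1 + x * q ^ 2) *
      (-2 + 2 * q + 5 * (x * q ^ 2) - 2 * (x * q ^ 3) - 3 * (x * q ^ 4) + 2 * (x * q ^ 5)
        + 2 * (x ^ 2 * q ^ 5) + 3 * (x ^ 2 * q ^ 6) - 2 * (x ^ 2 * q ^ 7) - x ^ 2 * q ^ 8
        - 6 * (x ^ 3 * q ^ 7) + 6 * (x ^ 3 * q ^ 8) - x ^ 3 * q ^ 9 - x ^ 3 * q ^ 10
        - 2 * (x ^ 4 * q ^ 10) - 2 * (x ^ 4 * q ^ 11) + 2 * (x ^ 4 * q ^ 12)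
        - x ^ 5 * q ^ 13 + x ^ 5 * q ^ 14)
  | 4 => (1 + x * q) * (-1 + x * q ^ 2) * (1 + x * q ^ 2) * (1 + x * q ^ 3) *
      (2 - q + x * q ^ 3)
  | _ => 0

/-- The quotient of the summands' hypergeometric parts at `n + i` and at `n`, normalised to be
polynomial for `i ≤ 4`. -/
noncomputable def shiftFactor (x y : RatFunc ℚ) (i : ℕ) : RatFunc ℚ :=
  (∏ j ∈ range i, (-(x * q ^ j) ^ 5 * (1 - q * (x * q ^ j) * y))) *
    ∏ j ∈ Ico i 4, (y - q ^ (j + 1) * x)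

/-- The numerator of the rational certificate for the recurrence. -/
noncomputable def certificate (x y : RatFunc ℚ) : RatFunc ℚ :=
  x ^ 16 * q ^ 20 * (1 - q ^ 5 * x ^ 2) * (1 + q * x) * (1 - q ^ 4 * x ^ 2) *
    (1 - q ^ 6 * x ^ 2) * (1 + q ^ 4 * x) *
    ((4 * x ^ 3 * q ^ 9 - 2 * x ^ 3 * q ^ 10)
      + (-4 * x ^ 2 * q ^ 5 - x ^ 2 * q ^ 8 - 3 * x ^ 3 * q ^ 8 + 7 * x ^ 3 * q ^ 9
        - 7 * x ^ 3 * q ^ 10 + x ^ 3 * q ^ 11 - 4 * x ^ 4 * q ^ 10 - x ^ 4 * q ^ 13) * y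
      + (2 * x * q ^ 2 + x * q ^ 4 + x * q ^ 5 + 3 * x ^ 2 * q ^ 4 - 7 * x ^ 2 * q ^ 5
        + 4 * x ^ 2 * q ^ 6 + 2 * x ^ 2 * q ^ 7 - x ^ 2 * q ^ 8 + 6 * x ^ 3 * q ^ 6
        - 4 * x ^ 3 * q ^ 8 + 4 * x ^ 3 * q ^ 9 + 3 * x ^ 4 * q ^ 9 - 7 * x ^ 4 * q ^ 10
        + 4 * x ^ 4 * q ^ 11 + 2 * x ^ 4 * q ^ 12 - x ^ 4 * q ^ 13 + 2 * x ^ 5 * q ^ 12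
        + x ^ 5 * q ^ 14 + x ^ 5 * q ^ 15) * y ^ 2
      + (-q + 3 * x * q ^ 2 - 3 * x * q ^ 3 + 2 * x * q ^ 4 - x ^ 2 * q ^ 3 + 4 * x ^ 2 * q ^ 4
        - 2 * x ^ 2 * q ^ 5 + 2 * x ^ 2 * q ^ 6 - x ^ 2 * q ^ 7 + 8 * x ^ 3 * q ^ 6
        - 4 * x ^ 3 * q ^ 8 + 2 * x ^ 3 * q ^ 9 - x ^ 4 * q ^ 8 + 4 * x ^ 4 * q ^ 9
        - 2 * x ^ 4 * q ^ 10 + 2 * x ^ 4 * q ^ 11 - x ^ 4 * q ^ 12 + 3 * x ^ 5 * q ^ 12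
        - 3 * x ^ 5 * q ^ 13 + 2 * x ^ 5 * q ^ 14 - x ^ 6 * q ^ 16) * y ^ 3
      + (-1 - x * q - 2 * x * q ^ 2 + x * q ^ 3 - 5 * x ^ 2 * q ^ 3 + 2 * x ^ 2 * q ^ 4
        - x ^ 2 * q ^ 5 - 3 * x ^ 3 * q ^ 5 + x ^ 3 * q ^ 6 - 3 * x ^ 3 * q ^ 7 + x ^ 3 * q ^ 8
        - 5 * x ^ 4 * q ^ 8 + 2 * x ^ 4 * q ^ 9 - x ^ 4 * q ^ 10 - x ^ 5 * q ^ 11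
        - 2 * x ^ 5 * q ^ 12 + x ^ 5 * q ^ 13 - x ^ 6 * q ^ 15) * y ^ 4)

lemma certificate_identity (x y : RatFunc ℚ) :
    ∑ i ∈ range 5, recCoeff x i * (shiftFactor x y i * traceFactor (x * q ^ i) y) =
      -(y * (1 - q * x * y) * (y - q ^ 4 * x)) * certificate x (q * y) -
        x * q ^ 4 * ((1 - y) * (1 - q * y ^ 2)) * certificate x y := by
  simp only [sum_range_succ, range_zero, sum_empty, shiftFactor, prod_range_succ, Ico_self,
    prod_empty, recCoeff, traceFactor, certificate,
    show Ico 0 4 = {0, 1, 2, 3} from rfl, show Ico 1 4 = {1, 2, 3} from rfl,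
    show Ico 2 4 = {2, 3} from rfl, show Ico 3 4 = {3} from rfl]
  simp
  ring

/-- The hypergeometric part of the summand of `W_3(n)`; the index `m` separates the dependence on
the upper summation bound, and equals `n` in the summand itself. -/
noncomputable def hyperTerm (n : ℕ) (m k : ℤ) : RatFunc ℚ :=
  triScale n / q * altWeight (2 * k) / altWeight (n + k) * qfac (n + k) *
    (qfac (m - k))⁻¹ * (qfac (2 * k + 1))⁻¹ / negPoch (-k - 1)

lemma hyperTerm_of_lt (n : ℕ) {m k : ℤ} (h : m < k) : hyperTerm n m k = 0 := by
  rw [hyperTerm, inv_qfac_of_neg (by omega)]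
  simp

lemma hyperTerm_pred (n : ℕ) (m k : ℤ) :
    hyperTerm n (m - 1) k = (1 - q ^ (m - k)) * hyperTerm n m k := by
  rw [hyperTerm, hyperTerm, sub_right_comm, inv_qfac_pred]
  ring

lemma triScale_succ (n : ℕ) : triScale (n + 1) = (q ^ n) ^ 6 * triScale n := by
  have e : 3 * ((n + 1 : ℕ) : ℤ) ^ 2 - 3 * (n + 1 : ℕ) + 1 =
      (n * 6 : ℕ) + (3 * (n : ℤ) ^ 2 - 3 * n + 1) := by push_cast; ring
  rw [triScale, triScale, e, zpow_add₀ q_ne_zero, zpow_natCast, pow_mul]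
  ring

lemma hyperTerm_succ_left (n : ℕ) (m : ℤ) (k : ℕ) :
    q ^ k * hyperTerm (n + 1) m k =
      -(q ^ n) ^ 5 * (1 - q * q ^ n * q ^ k) * hyperTerm n m k := by
  have h1 := altWeight_succ (n + k)
  have h2 := qfac_succ (by omega : (0 : ℤ) < n + k + 1)
  rw [add_sub_cancel_right, zpow_add₀ q_ne_zero, zpow_add₀ q_ne_zero, zpow_one] at h2
  rw [zpow_add₀ q_ne_zero] at h1
  rw [zpow_natCast, zpow_natCast] at h1 h2
  rw [hyperTerm, hyperTerm, triScale_succ, Nat.cast_succ, add_right_comm, h1, h2]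
  have h3 := pow_ne_zero n q_ne_zero
  have h4 := pow_ne_zero k q_ne_zero
  have h5 := altWeight_ne_zero (n + k)
  have h6 := negPoch_ne_zero (-k - 1)
  have h7 := q_ne_zero
  field_simp

lemma hyperTerm_succ_right (n : ℕ) (m : ℤ) (k : ℕ) :
    q ^ n * ((1 - q * q ^ k) * (1 - q ^ 3 * (q ^ k) ^ 2)) * hyperTerm n m (k + 1) =
      -(q ^ k) ^ 2 * (1 - q * q ^ n * q ^ k) * (1 - q ^ (m - k)) * hyperTerm n m k := by
  have ha := altWeight_succ (2 * k)
  have ha' := altWeight_succ (2 * k + 1)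
  have hb := altWeight_succ (n + k)
  have hf := qfac_succ (by omega : (0 : ℤ) < n + k + 1)
  have hm := inv_qfac_pred (m - k)
  have hi := inv_qfac_pred (2 * k + 1 + 1)
  have hi' := inv_qfac_pred (2 * k + 1 + 1 + 1)
  have hn := negPoch_succ (-k - 1)
  have e : ((-k - 1 : ℤ)) = -((k + 1 : ℕ) : ℤ) := by push_cast; ring
  have hz : q ^ (-k - 1 : ℤ) = (q * q ^ k)⁻¹ := by rw [e, zpow_neg, zpow_natCast, pow_succ']
  have hk := one_add_q_zpow_ne_zero (k + 1)
  rw [hz] at hn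
  simp only [zpow_add₀ q_ne_zero, q_zpow_two_mul, zpow_one, add_sub_cancel_right,
    zpow_natCast] at ha ha' hb hf hi hi' hk
  rw [hi'] at hi
  rw [hyperTerm, hyperTerm, show 2 * ((k : ℤ) + 1) = 2 * k + 1 + 1 by ring, ha', ha,
    ← add_assoc, hb, hf, ← sub_sub, hm, hi, hn, show -((k : ℤ) + 1) - 1 = -k - 1 - 1 by ring]
  have h3 := pow_ne_zero n q_ne_zero
  have h4 := pow_ne_zero k q_ne_zero
  have h5 := altWeight_ne_zero (n + k)
  have h6 := negPoch_ne_zero (-k - 1 - 1)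
  have h7 := q_ne_zero
  have h8 : 1 + q * q ^ k ≠ 0 := by rwa [mul_comm]
  have h9 : q * q ^ k + 1 ≠ 0 := by rwa [add_comm]
  field_simp
  ring

lemma invEntry_add (n : ℕ) (i k : ℤ) (h : 0 ≤ n + k + i) :
    (1 + q ^ (-k)) * invEntry n (n + k + i) (n + k) =
      altWeight (2 * k + i) * qfac (n + k + i) * (qfac (n - k))⁻¹ * (qfac (2 * k + i))⁻¹ /
        (altWeight (n + k) * negPoch (-k - 1)) := by
  rw [invEntry, rowWeight, qbinom_eq h, show (n : ℤ) - (n + k) = -k by ring, negPoch_succ (-k),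
    show (n : ℤ) + k + i + (n + k) - 2 * n = 2 * k + i by ring,
    show 2 * (n : ℤ) - (n + k) = n - k by ring,
    show (n : ℤ) + k + i - (n - k) = 2 * k + i by ring]
  have h1 := altWeight_ne_zero (n + k)
  have h2 := negPoch_ne_zero (-k - 1)
  have h3 := one_add_q_zpow_ne_zero (-k)
  field_simp

lemma trace_summand_eq {n : ℕ} (hn : 1 ≤ n) (k : ℕ) :
    triUp n (n + k) * invEntry n (n + k + 1) (n + k) +
      triDiag n (n + k) * invEntry n (n + k) (n + k) +
      triDown n (n + k) * invEntry n (n + k - 1) (n + k) =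
      hyperTerm n n k * traceFactor (q ^ n) (q ^ k) := by
  have hU := invEntry_add n 1 k (by omega)
  have hD := invEntry_add n 0 k (by omega)
  have hL := invEntry_add n (-1) k (by omega)
  have ha := altWeight_succ (2 * k)
  have ha' := altWeight_succ (2 * k - 1)
  have hf := qfac_succ (by omega : (0 : ℤ) < n + k + 1)
  have hf' := qfac_succ (by omega : (0 : ℤ) < n + k)
  have hi := inv_qfac_pred (2 * k + 1)
  have hi' := inv_qfac_pred (2 * k)
  rw [sub_add_cancel] at ha'
  rw [add_sub_cancel_right] at hf hi
  rw [hi] at hi'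
  simp only [add_zero, ← sub_eq_add_neg] at hU hD hL
  rw [ha, ha', hf, hf'] at hU
  rw [ha', hf', hi] at hD
  rw [hi'] at hL
  have hx := pow_ne_zero n q_ne_zero
  have hy := pow_ne_zero k q_ne_zero
  have hw := altWeight_ne_zero (n + k)
  have hp := negPoch_ne_zero (-k - 1)
  have hq := q_ne_zero
  rw [triUp, triDiag, triDown, hyperTerm, traceFactor, hf', ha',
    show (n : ℤ) - (n + k) = -k by ring]
  have key (a b c : RatFunc ℚ) : triScale n * a * b * c = triScale n * b * (a * c) := by ring
  rw [key, key, key, hU, hD, hL]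
  simp only [zpow_add₀ hq, zpow_sub₀ hq, q_zpow_two_mul, zpow_natCast, zpow_neg,
    zpow_ofNat]
  field_simp
  ring

lemma Wmul_three_eq_sum_hyperTerm {n L : ℕ} (hn : 1 ≤ n) (hL : n < L) :
    Wmul 3 n = ∑ k ∈ range L, hyperTerm n n k * traceFactor (q ^ n) (q ^ k) := by
  rw [Wmul_three_eq_sum hn, two_mul, add_assoc, sum_range_eq_of_eq_zero n]
  · rw [← sum_subset (range_subset_range.2 hL : range (n + 1) ⊆ range L)]
    · refine sum_congr rfl fun k _ => ?_
      rw [← trace_summand_eq hn, Nat.cast_add]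
    · intro k _ hk
      rw [mem_range] at hk
      rw [hyperTerm_of_lt n (by omega), zero_mul]
  · intro u hu
    rw [invEntry, invEntry, invEntry, qbinom_of_lt (by omega), qbinom_of_lt (by omega),
      qbinom_of_lt (by omega)]
    simp

lemma pow_mul_hyperTerm_add (n i : ℕ) (m : ℤ) (k : ℕ) :
    (q ^ k) ^ i * hyperTerm (n + i) m k =
      (∏ j ∈ range i, (-(q ^ n * q ^ j) ^ 5 * (1 - q * (q ^ n * q ^ j) * q ^ k))) *
        hyperTerm n m k := by
  induction i with
  | zero => simp
  | succ i ih =>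
    have h := hyperTerm_succ_left (n + i) m k
    rw [pow_add q n i] at h
    rw [prod_range_succ, pow_succ, mul_assoc, ← add_assoc, h]
    linear_combination (-(q ^ n * q ^ i) ^ 5 * (1 - q * (q ^ n * q ^ i) * q ^ k)) * ih

lemma pow_mul_hyperTerm_sub (N n i d k : ℕ) :
    (q ^ k) ^ d * hyperTerm N (n + i : ℕ) k =
      (∏ j ∈ Ico i (i + d), (q ^ k - q ^ (j + 1) * q ^ n)) * hyperTerm N (n + (i + d) : ℕ) k := by
  induction d with
  | zero => simp
  | succ d ih =>
    have h := hyperTerm_pred N (n + (i + (d + 1)) : ℕ) k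
    rw [zpow_sub₀ q_ne_zero, zpow_natCast, zpow_natCast,
      show ((n + (i + (d + 1)) : ℕ) : ℤ) - 1 = (n + (i + d) : ℕ) by push_cast; ring] at h
    rw [pow_succ', mul_assoc, ih, h, ← add_assoc i d 1, prod_Ico_succ_top (by omega)]
    have hy : q ^ k * (q ^ (n + (i + (d + 1))) / q ^ k) = q ^ (i + d + 1) * q ^ n := by
      rw [mul_div_cancel₀ _ (pow_ne_zero k q_ne_zero), ← pow_add]
      congr 1
      omega
    linear_combination (-(∏ j ∈ Ico i (i + d), (q ^ k - q ^ (j + 1) * q ^ n)) *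
      hyperTerm N (n + (i + (d + 1)) : ℕ) k) * hy

lemma pow_mul_hyperTerm_shift (n k : ℕ) {i : ℕ} (hi : i ≤ 4) :
    (q ^ k) ^ 4 * hyperTerm (n + i) (n + i : ℕ) k =
      shiftFactor (q ^ n) (q ^ k) i * hyperTerm n (n + 4 : ℕ) k := by
  obtain ⟨d, hd⟩ := Nat.exists_eq_add_of_le hi
  have h1 := pow_mul_hyperTerm_add n i (n + i : ℕ) k
  have h2 := pow_mul_hyperTerm_sub n n i d k
  rw [← hd] at h2
  rw [shiftFactor, mul_assoc, ← h2, mul_left_comm, ← h1, ← mul_assoc, ← pow_add, add_comm d, ← hd]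

/-- The telescoping antidifference. -/
noncomputable def antidiff (n k : ℕ) : RatFunc ℚ :=
  hyperTerm n (n + 4 : ℕ) k / (q ^ k) ^ 4 *
    (q ^ n * q ^ 4 * ((1 - q ^ k) * (1 - q * (q ^ k) ^ 2)) * certificate (q ^ n) (q ^ k))

lemma sum_recCoeff_mul_summand (n k : ℕ) :
    ∑ i ∈ range 5, recCoeff (q ^ n) i *
      (hyperTerm (n + i) (n + i : ℕ) k * traceFactor (q ^ (n + i)) (q ^ k)) =
      antidiff n (k + 1) - antidiff n k := by
  have hy := pow_ne_zero k q_ne_zero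
  have hq := q_ne_zero
  have h1 := certificate_identity (q ^ n) (q ^ k)
  have h2 := hyperTerm_succ_right n (n + 4 : ℕ) k
  rw [zpow_sub₀ hq, zpow_natCast, zpow_natCast, pow_add q n 4] at h2
  calc _ = hyperTerm n (n + 4 : ℕ) k / (q ^ k) ^ 4 * ∑ i ∈ range 5, recCoeff (q ^ n) i *
        (shiftFactor (q ^ n) (q ^ k) i * traceFactor (q ^ n * q ^ i) (q ^ k)) := by
        rw [mul_sum]
        refine sum_congr rfl fun i hi => ?_
        have h := pow_mul_hyperTerm_shift n k (by rw [mem_range] at hi; omega : i ≤ 4)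
        rw [← pow_add]
        field_simp
        linear_combination traceFactor (q ^ (n + i)) (q ^ k) * recCoeff (q ^ n) i * h
    _ = _ := by
        rw [h1, antidiff, antidiff, pow_succ' q k, Nat.cast_succ k]
        field_simp at h2 ⊢
        linear_combination (-certificate (q ^ n) (q * q ^ k)) * h2

lemma sum_recCoeff_mul_Wmul {n : ℕ} (hn : 1 ≤ n) :
    ∑ i ∈ range 5, recCoeff (q ^ n) i * Wmul 3 (n + i) = 0 := by
  have h : ∀ i ∈ range 5, recCoeff (q ^ n) i * Wmul 3 (n + i) = ∑ k ∈ range (n + 5),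
      recCoeff (q ^ n) i *
        (hyperTerm (n + i) (n + i : ℕ) k * traceFactor (q ^ (n + i)) (q ^ k)) := by
    intro i hi
    rw [mem_range] at hi
    rw [Wmul_three_eq_sum_hyperTerm (by omega) (by omega : n + i < n + 5), mul_sum]
  rw [sum_congr rfl h, sum_comm, sum_congr rfl fun k _ => sum_recCoeff_mul_summand n k,
    sum_range_sub, antidiff, antidiff, hyperTerm_of_lt n (by omega)]
  simp

end CarlitzSum

/-- Lemma 3.2 (fourth recurrence): the five-term recurrence for `W_3`. -/
theorem W3_recurrence (n : ℕ) (hn : 1 ≤ n) :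
    0 = -(q ^ (15 * n + 24)) * (1 + q ^ (n + 2)) * (-1 + q ^ (n + 3)) * (1 + q ^ (n + 3)) *
          (1 + q ^ (n + 4)) * (-1 - 2 * q ^ (n + 2) + q ^ (n + 3)) * Wmul 3 n
      - q ^ (11 * n + 23) * (1 + q ^ (n + 3)) * (1 + q ^ (n + 4)) *
          (-1 + q - 2 * q ^ (n + 2) - 2 * q ^ (n + 3) + 2 * q ^ (n + 4) - 6 * q ^ (2 * n + 4)
            + 6 * q ^ (2 * n + 5) - q ^ (2 * n + 6) - q ^ (2 * n + 7) + 2 * q ^ (3 * n + 7)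
            + 3 * q ^ (3 * n + 8) - 2 * q ^ (3 * n + 9) - q ^ (3 * n + 10) + 5 * q ^ (4 * n + 9)
            - 2 * q ^ (4 * n + 10) - 3 * q ^ (4 * n + 11) + 2 * q ^ (4 * n + 12)
            - 2 * q ^ (5 * n + 12) + 2 * q ^ (5 * n + 13)) * Wmul 3 (n + 1)
      + q ^ (6 * n + 18) * (1 + q ^ (n + 1)) * (1 + q ^ (n + 4)) * (-1 + q ^ (2 * n + 5)) *
          (1 + 2 * q ^ (n + 1) - q ^ (n + 3) + 7 * q ^ (2 * n + 3) - 6 * q ^ (2 * n + 4)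
            - 2 * q ^ (2 * n + 5) + q ^ (2 * n + 6) + 2 * q ^ (3 * n + 6) - q ^ (3 * n + 8)
            + q ^ (4 * n + 10)) * Wmul 3 (n + 2)
      + q ^ (2 * n + 8) * (1 + q ^ (n + 1)) * (1 + q ^ (n + 2)) *
          (-2 + 2 * q + 5 * q ^ (n + 2) - 2 * q ^ (n + 3) - 3 * q ^ (n + 4) + 2 * q ^ (n + 5)
            + 2 * q ^ (2 * n + 5) + 3 * q ^ (2 * n + 6) - 2 * q ^ (2 * n + 7) - q ^ (2 * n + 8)
            - 6 * q ^ (3 * n + 7) + 6 * q ^ (3 * n + 8) - q ^ (3 * n + 9) - q ^ (3 * n + 10)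
            - 2 * q ^ (4 * n + 10) - 2 * q ^ (4 * n + 11) + 2 * q ^ (4 * n + 12)
            - q ^ (5 * n + 13) + q ^ (5 * n + 14)) * Wmul 3 (n + 3)
      + (1 + q ^ (n + 1)) * (-1 + q ^ (n + 2)) * (1 + q ^ (n + 2)) * (1 + q ^ (n + 3)) *
          (2 - q + q ^ (n + 3)) * Wmul 3 (n + 4) := by
  have h := CarlitzSum.sum_recCoeff_mul_Wmul hn
  simp only [sum_range_succ, range_zero, sum_empty, zero_add, add_zero, CarlitzSum.recCoeff] at h
  rw [← h]
  simp only [pow_add, pow_mul', pow_one]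
  ring
end
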